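/- arXiv:1607.07653 — 6 statements merged into one kernel-verified Lean document; each statement's English description precedes it below -/
import Mathlib

section
/- Let n be an integer with n > 1. A finitely generated abelian group G is isomorphic to the group G(A) generated by some invertible n-state time-varying automaton A over the binary alphabet {0,1} if and only if G has rank at most n and the torsion part of G is a 2-group. -/
/-- The automorphism group of the rooted binary tree `{0,1}*`, realized as the subgroup of
permutations of `List Bool` (finite binary words, with `[]` the root and `w` adjacent to
`w ++ [x]`) consisting of those permutations that fix the root and map children of a vertex
to children of its image (equivalently, bijections fixing the root and preserving adjacency). -/
def binTreeAut : Subgroup (Equiv.Perm (List Bool)) where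
  carrier := {f | f [] = [] ∧ ∀ (w : List Bool) (x : Bool), ∃ y : Bool, f (w ++ [x]) = f w ++ [y]}
  one_mem' := ⟨rfl, fun w x => ⟨x, rfl⟩⟩
  mul_mem' := by
    rintro f g ⟨hf0, hf⟩ ⟨hg0, hg⟩
    refine ⟨by simp [Equiv.Perm.mul_apply, hg0, hf0], ?_⟩
    intro w x
    obtain ⟨y, hy⟩ := hg w x
    obtain ⟨z, hz⟩ := hf (g w) y
    exact ⟨z, by simp [Equiv.Perm.mul_apply, hy, hz]⟩
  inv_mem' := by
    rintro f ⟨hf0, hf⟩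
    constructor
    · have h : f⁻¹ (f []) = [] := Equiv.symm_apply_apply f []
      rwa [hf0] at h
    · intro w x
      have hfv : f (f⁻¹ (w ++ [x])) = w ++ [x] := Equiv.apply_symm_apply f (w ++ [x])
      rcases List.eq_nil_or_concat (f⁻¹ (w ++ [x])) with hnil | ⟨w', x', hcons⟩
      · rw [hnil, hf0] at hfv
        exact absurd hfv.symm (by simp)
      · rw [hcons, List.concat_eq_append] at hfv
        obtain ⟨y, hy⟩ := hf w' x'
        rw [hy] at hfv
        have h2 := List.append_inj' hfv rfl
        have hw' : w' = f⁻¹ w := by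
          rw [← h2.1]; exact (Equiv.symm_apply_apply f w').symm
        refine ⟨x', ?_⟩
        rw [hcons, List.concat_eq_append, hw']

/-- A time-varying automaton over the binary alphabet `{0,1}` (encoded as `Bool`) with state
set `Q`: a sequence of transition functions and a sequence of output functions.  (Indexing of
the transitions starts here at `0`, corresponding to the first transition.) -/
structure TVAutomaton (Q : Type*) where
  phi : ℕ → Q → Bool → Q
  psi : ℕ → Q → Bool → Bool

namespace TVAutomaton

variable {Q : Type*}

/-- An automaton is invertible if all labelings `x ↦ psi i q x` are bijections. -/
def Invertible (A : TVAutomaton Q) : Prop := ∀ i q, Function.Bijective (A.psi i q)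

/-- A Mealy automaton is a time-varying automaton whose sequences of transition and output
functions are constant. -/
def IsMealy (A : TVAutomaton Q) : Prop := ∀ i, A.phi i = A.phi 0 ∧ A.psi i = A.psi 0

/-- The automaton transformation of the state `q` in its `i`-th transition. -/
def act (A : TVAutomaton Q) : ℕ → Q → List Bool → List Bool
  | _, _, [] => []
  | i, q, x :: w => A.psi i q x :: A.act (i + 1) (A.phi i q x) w

/-- The inverse automaton transformation (for invertible automata). -/
noncomputable def invAct (A : TVAutomaton Q) : ℕ → Q → List Bool → List Bool
  | _, _, [] => []
  | i, q, y :: u =>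
    Function.invFun (A.psi i q) y ::
      A.invAct (i + 1) (A.phi i q (Function.invFun (A.psi i q) y)) u

theorem act_invAct (A : TVAutomaton Q) (h : A.Invertible) :
    ∀ (u : List Bool) (i : ℕ) (q : Q), A.act i q (A.invAct i q u) = u := by
  intro u
  induction u with
  | nil => intro i q; rfl
  | cons y u ih =>
    intro i q
    rw [invAct, act, ih]
    congr 1
    exact Function.rightInverse_invFun (h i q).2 y

theorem invAct_act (A : TVAutomaton Q) (h : A.Invertible) :
    ∀ (w : List Bool) (i : ℕ) (q : Q), A.invAct i q (A.act i q w) = w := by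
  intro w
  induction w with
  | nil => intro i q; rfl
  | cons x w ih =>
    intro i q
    have hx : Function.invFun (A.psi i q) (A.psi i q x) = x :=
      Function.leftInverse_invFun (h i q).1 x
    rw [act, invAct, hx, ih]

/-- The automaton transformation of the state `q` in its `i`-th transition, as a
permutation of the set of binary words. -/
noncomputable def toPerm (A : TVAutomaton Q) (h : A.Invertible) (i : ℕ) (q : Q) :
    Equiv.Perm (List Bool) where
  toFun := A.act i q
  invFun := A.invAct i q
  left_inv := fun w => A.invAct_act h w i q
  right_inv := fun u => A.act_invAct h u i q

theorem act_concat (A : TVAutomaton Q) :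
    ∀ (w : List Bool) (i : ℕ) (q : Q) (x : Bool),
      ∃ y, A.act i q (w ++ [x]) = A.act i q w ++ [y] := by
  intro w
  induction w with
  | nil => intro i q x; exact ⟨A.psi i q x, rfl⟩
  | cons a w ih =>
    intro i q x
    obtain ⟨y, hy⟩ := ih (i + 1) (A.phi i q a) x
    refine ⟨y, ?_⟩
    show A.psi i q a :: A.act (i + 1) (A.phi i q a) (w ++ [x]) = _
    rw [hy]; rfl

/-- The automaton transformation of the state `q` in its `i`-th transition, as an
automorphism of the rooted binary tree. -/
noncomputable def toAut (A : TVAutomaton Q) (h : A.Invertible) (i : ℕ) (q : Q) :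
    ↥binTreeAut :=
  ⟨A.toPerm h i q, ⟨rfl, fun w x => A.act_concat w i q x⟩⟩

/-- The group `G(A)` generated by an invertible time-varying automaton `A`: the subgroup of
`Aut({0,1}*)` generated by the transformations of all states of `A` in their first
transition. -/
noncomputable def genGroup (A : TVAutomaton Q) (h : A.Invertible) : Subgroup ↥binTreeAut :=
  Subgroup.closure (Set.range fun q => A.toAut h 0 q)

end TVAutomaton

/-- A tree automorphism belongs to the first level stabilizer: it fixes both one-letter
words. -/
def FixesLevelOne (g : ↥binTreeAut) : Prop :=
  (g : Equiv.Perm (List Bool)) [false] = [false] ∧ (g : Equiv.Perm (List Bool)) [true] = [true]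

/-- One level of an abelian automaton: integer exponent vectors of the states act on letters
through `out`, with sections `sec` again described by exponent vectors, and `next` is the
transition function of the states. -/
structure AbelianStep (n : ℕ) where
  out : (Fin n → ℤ) → Bool → Bool
  sec : (Fin n → ℤ) → Bool → Fin n → ℤ
  next : Fin n → Bool → Fin n
  out_zero : ∀ c, out 0 c = c
  out_add : ∀ x y c, out (x + y) c = out x (out y c)
  sec_add : ∀ x y c, sec (x + y) c = sec x (out y c) + sec y c
  sec_single : ∀ q c, sec (Pi.single q 1) c = Pi.single (next q c) 1

namespace AbelianStep

variable {n : ℕ}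

theorem sec_zero (s : AbelianStep n) (c : Bool) : s.sec 0 c = 0 := by
  have h := s.sec_add 0 0 c
  rw [add_zero, s.out_zero] at h
  exact left_eq_add.mp h

/-- The action of an exponent vector on binary words along a sequence of abelian steps. -/
def act : (ℕ → AbelianStep n) → (Fin n → ℤ) → List Bool → List Bool
  | _, _, [] => []
  | S, x, c :: w => (S 0).out x c :: act (fun i => S (i + 1)) ((S 0).sec x c) w

theorem act_zero (w : List Bool) : ∀ S : ℕ → AbelianStep n, act S 0 w = w := by
  induction w with
  | nil => intro S; rfl
  | cons c w ih => intro S; simp [act, out_zero, sec_zero, ih]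

theorem act_add (w : List Bool) : ∀ (S : ℕ → AbelianStep n) (x y : Fin n → ℤ),
    act S (x + y) w = act S x (act S y w) := by
  induction w with
  | nil => intros; rfl
  | cons c w ih => intro S x y; simp [act, out_add, sec_add, ih]

theorem act_concat (w : List Bool) : ∀ (S : ℕ → AbelianStep n) (x : Fin n → ℤ) (c : Bool),
    ∃ d, act S x (w ++ [c]) = act S x w ++ [d] := by
  induction w with
  | nil => intro S x c; exact ⟨(S 0).out x c, rfl⟩
  | cons a w ih =>
    intro S x c
    obtain ⟨d, hd⟩ := ih (fun i => S (i + 1)) ((S 0).sec x a) c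
    exact ⟨d, by simp [act, hd]⟩

/-- The time-varying automaton whose levels are the given abelian steps. -/
def automaton (S : ℕ → AbelianStep n) : TVAutomaton (Fin n) where
  phi i q c := (S i).next q c
  psi i q c := (S i).out (Pi.single q 1) c

theorem automaton_invertible (S : ℕ → AbelianStep n) : (automaton S).Invertible := by
  intro i q
  refine Function.bijective_iff_has_inverse.mpr ⟨(S i).out (-Pi.single q 1), fun c => ?_,
    fun c => ?_⟩ <;> simp [automaton, ← out_add, out_zero]

theorem automaton_act (w : List Bool) : ∀ (S : ℕ → AbelianStep n) (i : ℕ) (q : Fin n),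
    (automaton S).act i q w = act (fun k => S (k + i)) (Pi.single q 1) w := by
  induction w with
  | nil => intros; rfl
  | cons c w ih =>
    intro S i q
    simp only [TVAutomaton.act, act, ih, sec_single, zero_add]
    simp [automaton, add_assoc, add_comm 1 i]

/-- The homomorphism from exponent vectors to tree automorphisms. -/
def actHom (S : ℕ → AbelianStep n) : Multiplicative (Fin n → ℤ) →* ↥binTreeAut where
  toFun x :=
    ⟨{  toFun := act S x.toAdd
        invFun := act S (-x.toAdd)
        left_inv := fun w => by rw [← act_add, neg_add_cancel, act_zero]
        right_inv := fun w => by rw [← act_add, add_neg_cancel, act_zero] },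
      rfl, fun w c => act_concat w S x.toAdd c⟩
  map_one' := by
    ext w : 2
    exact act_zero w S
  map_mul' x y := by
    ext w : 2
    exact act_add w S x.toAdd y.toAdd

theorem actHom_eq_one_iff (S : ℕ → AbelianStep n) (x : Multiplicative (Fin n → ℤ)) :
    actHom S x = 1 ↔ ∀ w, act S x.toAdd w = w := by
  rw [Subtype.ext_iff, Equiv.ext_iff]
  rfl

theorem closure_range_ofAdd_single :
    Subgroup.closure (Set.range fun q : Fin n =>
      Multiplicative.ofAdd (Pi.single q (1 : ℤ) : Fin n → ℤ)) = ⊤ := by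
  rw [eq_top_iff]
  intro x _
  have hx : x = ∏ q, Multiplicative.ofAdd (Pi.single q (1 : ℤ) : Fin n → ℤ) ^ (x.toAdd q) := by
    apply Multiplicative.toAdd.injective
    rw [toAdd_prod]
    ext j
    simp [Finset.sum_apply, Pi.single_apply]
  rw [hx]
  exact Subgroup.prod_mem _ fun q _ =>
    Subgroup.zpow_mem _ (Subgroup.subset_closure (Set.mem_range_self q)) _

theorem actHom_range (S : ℕ → AbelianStep n) :
    (actHom S).range = (automaton S).genGroup (automaton_invertible S) := by
  rw [MonoidHom.range_eq_map, ← closure_range_ofAdd_single, MonoidHom.map_closure,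
    TVAutomaton.genGroup, ← Set.range_comp]
  congr 2
  ext q w : 3
  exact (automaton_act w S 0 q).symm

/-- The relation set `K` is realized if it consists exactly of the exponent vectors acting
trivially along some sequence of abelian steps. -/
def Realizable (K : Set (Fin n → ℤ)) : Prop :=
  ∃ S : ℕ → AbelianStep n, ∀ x, x ∈ K ↔ ∀ w, act S x w = w

theorem Realizable.exists_mulEquiv {G : Type*} [Group G] {K : Set (Fin n → ℤ)}
    (hK : Realizable K) (f : Multiplicative (Fin n → ℤ) →* G) (hf : Function.Surjective f)
    (hker : ∀ x, f x = 1 ↔ x.toAdd ∈ K) :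
    ∃ (A : TVAutomaton (Fin n)) (h : A.Invertible), Nonempty (G ≃* A.genGroup h) := by
  obtain ⟨S, hS⟩ := hK
  have hkers : f.ker = (actHom S).ker := by
    ext x
    rw [MonoidHom.mem_ker, MonoidHom.mem_ker, hker, hS, actHom_eq_one_iff]
  exact ⟨automaton S, automaton_invertible S,
    ⟨(QuotientGroup.quotientKerEquivOfSurjective f hf).symm.trans
      ((QuotientGroup.quotientMulEquivOfEq hkers).trans
        ((QuotientGroup.quotientKerEquivRange (actHom S)).trans
          (MulEquiv.subgroupCongr (actHom_range S))))⟩⟩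

theorem Realizable.cons {K : Set (Fin n → ℤ)} (hK : Realizable K) (s : AbelianStep n) :
    Realizable {x | ∀ c, s.out x c = c ∧ s.sec x c ∈ K} := by
  obtain ⟨S, hS⟩ := hK
  refine ⟨fun i => Nat.casesOn i s S, fun x => ⟨fun hx w => ?_, fun hx c => ⟨?_, ?_⟩⟩⟩
  · cases w with
    | nil => rfl
    | cons c w => simp [act, (hx c).1, (hS _).mp (hx c).2 w]
  · exact (List.cons.inj (hx [c])).1
  · exact (hS _).mpr fun w => (List.cons.inj (hx (c :: w))).2

/-- The image of an exponent vector under a map of the states. -/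
def push (f : Fin n → Fin n) (x : Fin n → ℤ) : Fin n → ℤ :=
  fun j => ∑ i, if f i = j then x i else 0

theorem sum_push (f : Fin n → Fin n) (x : Fin n → ℤ) : ∑ j, push f x j = ∑ j, x j := by
  simp only [push]
  rw [Finset.sum_comm]
  simp

theorem push_apply_of_injective {f : Fin n → Fin n} (hf : Function.Injective f)
    (x : Fin n → ℤ) (i : Fin n) : push f x (f i) = x i := by
  simp [push, hf.eq_iff]

/-- The step fixing all letters and changing states by `f c` after reading `c`. -/
def inactive (f : Bool → Fin n → Fin n) : AbelianStep n where
  out _ c := c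
  sec x c := push (f c) x
  next q c := f c q
  out_zero _ := rfl
  out_add _ _ _ := rfl
  sec_add x y c := by
    ext j
    simp only [push, Pi.add_apply, ← Finset.sum_add_distrib]
    exact Finset.sum_congr rfl fun i _ => by split_ifs <;> simp
  sec_single q c := by
    ext j
    rw [push, Finset.sum_eq_single q (fun i _ hi => by simp [hi]) (by simp)]
    simp [Pi.single_apply, eq_comm]

/-- The step in which only `t` changes letters: `t = (p, t)σ`, while the other states are
unchanged. -/
def halving (t p : Fin n) (htp : p ≠ t) : AbelianStep n where
  out x c := xor c (decide (x t % 2 = 1))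
  sec x c j :=
    if j = t then (x t + c.toNat) / 2
    else if j = p then x p + (x t + 1 - c.toNat) / 2
    else x j
  next q c := if q = t then (if c then t else p) else q
  out_zero c := by simp
  out_add x y c := by
    have h := Int.emod_two_eq_zero_or_one (x t)
    have h' := Int.emod_two_eq_zero_or_one (y t)
    rcases h with h | h <;> rcases h' with h' | h' <;> cases c <;>
      simp [Int.add_emod, h, h']
  sec_add x y c := by
    have h := Int.emod_two_eq_zero_or_one (x t)
    have h' := Int.emod_two_eq_zero_or_one (y t)
    ext j
    rcases h' with h' | h' <;> cases c <;> simp [h'] <;> split_ifs <;> omega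
  sec_single q c := by
    ext j
    by_cases hq : q = t
    · subst hq
      cases c <;> simp [Pi.single_apply, htp] <;> split_ifs <;> simp_all
    · cases c <;> simp [Pi.single_apply, hq, Ne.symm hq] <;> split_ifs <;> simp_all

theorem realizable_univ : Realizable (Set.univ : Set (Fin n → ℤ)) := by
  refine ⟨fun _ => inactive fun _ => id, fun x => ⟨fun _ w => ?_, fun _ => trivial⟩⟩
  induction w generalizing x with
  | nil => rfl
  | cons c w ih => exact congrArg (c :: ·) (ih _ trivial)

theorem halving_out_eq_self_iff {t p : Fin n} (htp : p ≠ t) (x : Fin n → ℤ) (c : Bool) :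
    (halving t p htp).out x c = c ↔ (2 : ℤ) ∣ x t := by
  rw [Int.dvd_iff_emod_eq_zero]
  rcases Int.emod_two_eq_zero_or_one (x t) with h | h <;> simp [halving, h]

theorem halving_sec_of_even {t p : Fin n} (htp : p ≠ t) {x : Fin n → ℤ} (hx : 2 ∣ x t)
    (c : Bool) (j : Fin n) : (halving t p htp).sec x c j =
      if j = t then x t / 2 else if j = p then x p + x t / 2 else x j := by
  cases c <;> simp [halving] <;> split_ifs <;> omega

theorem realizable_apply_eq_zero {t p : Fin n} (htp : p ≠ t) :
    Realizable {x : Fin n → ℤ | x t = 0} := by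
  refine ⟨fun _ => halving t p htp, fun x => ⟨fun hx w => ?_, fun hx => ?_⟩⟩
  · induction w generalizing x with
    | nil => rfl
    | cons c w ih =>
      have hx' : x t = 0 := hx
      have he : (2 : ℤ) ∣ x t := by simp [hx']
      simp only [act, (halving_out_eq_self_iff htp x c).mpr he]
      rw [ih]
      simp [halving_sec_of_even htp he, hx']
  · have key : ∀ (k : ℕ) (y : Fin n → ℤ), (∀ w, act (fun _ => halving t p htp) y w = w) →
        (2 : ℤ) ^ k ∣ y t := by
      intro k
      induction k with
      | zero => simp
      | succ k ih =>
        intro y hy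
        have he := (halving_out_eq_self_iff htp y false).mp (List.cons.inj (hy [false])).1
        have hd := ih _ fun w => (List.cons.inj (hy (false :: w))).2
        simp only [halving_sec_of_even htp he, if_true] at hd
        rw [pow_succ]
        obtain ⟨a, ha⟩ := hd
        exact ⟨a, by rw [mul_right_comm, ← ha]; omega⟩
    by_contra hne
    have h := Int.le_of_dvd (abs_pos.mpr hne) ((dvd_abs _ _).mpr (key (x t).natAbs x hx))
    have h2 : (x t).natAbs < 2 ^ (x t).natAbs := Nat.lt_two_pow_self
    rw [Int.abs_eq_natAbs] at h
    exact absurd h2 (by exact_mod_cast h.not_gt)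

theorem two_mul_dvd_iff (m : ℕ) (x : ℤ) :
    ((2 * m : ℕ) : ℤ) ∣ x ↔ 2 ∣ x ∧ (m : ℤ) ∣ x / 2 := by
  rw [Nat.cast_mul, Nat.cast_two]
  constructor
  · rintro ⟨a, rfl⟩
    rw [mul_assoc, Int.mul_ediv_cancel_left _ two_ne_zero]
    exact ⟨⟨_, rfl⟩, a, rfl⟩
  · rintro ⟨h2, a, ha⟩
    exact ⟨a, by rw [mul_assoc, ← ha]; omega⟩

theorem Realizable.halve {K : Set (Fin n → ℤ)} (hK : Realizable K) {t p : Fin n}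
    (htp : p ≠ t) : Realizable {x : Fin n → ℤ | 2 ∣ x t ∧
      (fun j => if j = t then x t / 2 else if j = p then x p + x t / 2 else x j) ∈ K} := by
  convert hK.cons (halving t p htp) using 1
  ext x
  simp only [Set.mem_ofPred_eq, halving_out_eq_self_iff]
  constructor
  · rintro ⟨he, hx⟩ c
    exact ⟨he, by convert hx using 1; exact funext (halving_sec_of_even htp he c)⟩
  · intro h
    obtain ⟨he, hx⟩ := h false
    exact ⟨he, by convert hx using 1; exact (funext (halving_sec_of_even htp he false)).symm⟩

theorem realizable_dvd_apply {t p : Fin n} (htp : p ≠ t) (e : ℕ) :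
    Realizable {x : Fin n → ℤ | ((2 ^ e : ℕ) : ℤ) ∣ x t} := by
  induction e with
  | zero => simpa using realizable_univ
  | succ e ih =>
    convert ih.halve htp using 1
    ext x
    simp only [Set.mem_ofPred_eq, if_true]
    rw [pow_succ', two_mul_dvd_iff]

theorem Realizable.forall_mem_dvd {m : ℕ} {a : Fin n}
    (h : Realizable {x : Fin n → ℤ | (m : ℤ) ∣ x a}) (J : Finset (Fin n)) :
    Realizable {x : Fin n → ℤ | ∀ j ∈ insert a J, (m : ℤ) ∣ x j} := by
  induction J using Finset.induction_on with
  | empty => simpa using h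
  | insert b J hb ih =>
    by_cases hba : b ∈ insert a J
    · rwa [Finset.insert_comm, Finset.insert_eq_self.mpr hba]
    convert ih.cons (inactive fun c => if c then Equiv.swap a b else id) using 1
    have hid : ∀ x : Fin n → ℤ, push id x = x := fun x =>
      funext fun j => push_apply_of_injective Function.injective_id x j
    have hswap : ∀ (x : Fin n → ℤ) (j : Fin n),
        push (Equiv.swap a b) x j = x (Equiv.swap a b j) := fun x j => by
      conv_lhs => rw [← Equiv.swap_apply_self a b j]
      exact push_apply_of_injective (Equiv.swap a b).injective x _
    ext x
    simp only [inactive, Bool.forall_bool, Set.mem_ofPred_eq, true_and, if_true, hswap,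
      Bool.false_eq_true, if_false, hid]
    constructor
    · intro hx
      refine ⟨fun j hj => hx j (by grind), fun j hj => hx _ ?_⟩
      rcases eq_or_ne j a with rfl | hja
      · simp
      · rw [Equiv.swap_apply_of_ne_of_ne hja (by rintro rfl; exact hba hj)]
        grind
    · rintro ⟨h1, h2⟩ j hj
      rcases eq_or_ne j b with rfl | hjb
      · simpa using h2 a (by simp)
      · exact h1 j (by grind)

/-- The exponent vectors whose coordinate sum is divisible by `k p` and whose `j`-th coordinate
is divisible by `k j` for `j ≠ p`. -/
def sumRelations (p : Fin n) (k : Fin n → ℕ) : Set (Fin n → ℤ) :=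
  {x | (k p : ℤ) ∣ ∑ j, x j ∧ ∀ j, j ≠ p → (k j : ℤ) ∣ x j}

theorem Realizable.sumRelations_ite {m : ℕ} {J : Finset (Fin n)} {p : Fin n} (hp : p ∈ J)
    (h : Realizable {x : Fin n → ℤ | ∀ j ∈ J, (m : ℤ) ∣ x j}) :
    Realizable (sumRelations p fun j => if j ∈ J then m else 1) := by
  convert h.cons (inactive fun _ q => if q ∈ J then q else p) using 1
  ext x
  set y := push (fun q => if q ∈ J then q else p) x with hy
  have hsum : ∑ j, x j = ∑ j, y j := (sum_push _ x).symm
  have hmem : ∀ j ∈ J, j ≠ p → y j = x j := by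
    intro j hj hjp
    rw [hy, push, Finset.sum_eq_single j _ (by simp)]
    · simp [hj]
    · intro i _ hij
      rw [if_neg]
      split_ifs
      · exact hij
      · exact hjp.symm
  have hnot : ∀ j ∉ J, y j = 0 := by
    intro j hj
    rw [hy, push, Finset.sum_eq_zero]
    intro i _
    rw [if_neg]
    split_ifs with hi
    · rintro rfl; exact hj hi
    · rintro rfl; exact hj hp
  have hmem' : ∀ j, j ≠ p → ((((if j ∈ J then m else 1 : ℕ)) : ℤ) ∣ x j ↔ (m : ℤ) ∣ y j) := by
    intro j hjp
    by_cases hj : j ∈ J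
    · simp [hj, hmem j hj hjp]
    · simp [hj, hnot j hj]
  simp only [sumRelations, Set.mem_ofPred_eq, inactive, true_and, forall_const, ← hy, hp, if_true,
    hsum]
  constructor
  · rintro ⟨h1, h2⟩ j hj
    rcases eq_or_ne j p with rfl | hjp
    · rw [← Finset.add_sum_erase _ _ (Finset.mem_univ j)] at h1
      refine (dvd_add_left (Finset.dvd_sum fun i hi => ?_)).mp h1
      exact (hmem' i (Finset.ne_of_mem_erase hi)).mp (h2 i (Finset.ne_of_mem_erase hi))
    · exact (hmem' j hjp).mp (h2 j hjp)
  · intro hJ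
    have hall : ∀ j, (m : ℤ) ∣ y j := fun j => by
      by_cases hj : j ∈ J
      · exact hJ j hj
      · simp [hnot j hj]
    exact ⟨Finset.dvd_sum fun j _ => hall j, fun j hjp => (hmem' j hjp).mpr (hall j)⟩

theorem Realizable.sumRelations_double {p t : Fin n} {k : Fin n → ℕ} (htp : p ≠ t)
    (h : Realizable (sumRelations p k)) :
    Realizable (sumRelations p (Function.update k t (2 * k t))) := by
  convert h.halve htp using 1
  ext x
  have hsum : 2 ∣ x t → ∑ j, (if j = t then x t / 2 else if j = p then x p + x t / 2 else x j) =
      ∑ j, x j := by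
    intro h2
    rw [← sub_eq_zero, ← Finset.sum_sub_distrib,
      Finset.sum_eq_add_of_mem t p (Finset.mem_univ _) (Finset.mem_univ _) htp.symm
        (fun j _ hj => by simp [hj.1, hj.2])]
    simp only [if_true, if_neg htp]
    omega
  simp only [sumRelations, Set.mem_ofPred_eq, Function.update_of_ne htp]
  constructor
  · rintro ⟨h1, h2⟩
    have htt := h2 t htp.symm
    rw [Function.update_self, two_mul_dvd_iff] at htt
    refine ⟨htt.1, by rwa [hsum htt.1], fun j hj => ?_⟩
    rcases eq_or_ne j t with rfl | hjt
    · simpa using htt.2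
    · simpa [hjt, hj] using h2 j hj
  · rintro ⟨h0, h1, h2⟩
    refine ⟨by rwa [hsum h0] at h1, fun j hj => ?_⟩
    rcases eq_or_ne j t with rfl | hjt
    · rw [Function.update_self, two_mul_dvd_iff]
      exact ⟨h0, by simpa using h2 j hj⟩
    · simpa [hjt, hj] using h2 j hj

theorem Realizable.sumRelations_mul_pow {p : Fin n} {k : Fin n → ℕ}
    (h : Realizable (sumRelations p k)) (e : Fin n → ℕ) (he : e p = 0) :
    Realizable (sumRelations p fun j => k j * 2 ^ e j) := by
  induction hN : ∑ j, e j generalizing e with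
  | zero =>
    have he0 : ∀ j, e j = 0 := by simpa using hN
    simpa [he0] using h
  | succ N ih =>
    obtain ⟨t, ht⟩ : ∃ t, e t ≠ 0 := by
      by_contra! hall
      simp [hall] at hN
    have hpt : p ≠ t := by rintro rfl; exact ht he
    have hrec := (ih (Function.update e t (e t - 1)) (by rw [Function.update_of_ne hpt, he]) (by
      rw [Finset.sum_update_of_mem (Finset.mem_univ t)]
      rw [← Finset.add_sum_erase _ _ (Finset.mem_univ t)] at hN
      rw [Finset.sdiff_singleton_eq_erase]
      omega)).sumRelations_double hpt
    convert hrec using 2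
    ext j
    rcases eq_or_ne j t with rfl | hjt
    · simp only [Function.update_self]
      rw [mul_left_comm, ← pow_succ', Nat.sub_add_cancel (Nat.pos_of_ne_zero ht)]
    · simp [hjt]

theorem exists_realizable_sumRelations (hn : 1 < n) (k : Fin n → ℕ)
    (hk : ∀ j, k j = 0 ∨ ∃ e, k j = 2 ^ e) : ∃ p, Realizable (sumRelations p k) := by
  have : Nontrivial (Fin n) := Fin.nontrivial_iff_two_le.mpr hn
  suffices H : ∃ (p : Fin n) (J : Finset (Fin n)), p ∈ J ∧ (∀ j ∈ J, k j = k p) ∧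
      (∀ j ∉ J, k j ≠ 0) by
    obtain ⟨p, J, hp, hJ, hJ'⟩ := H
    obtain ⟨q, hq⟩ := exists_ne p
    have hbase : Realizable {x : Fin n → ℤ | (k p : ℤ) ∣ x p} := by
      rcases hk p with h0 | ⟨e, he⟩
      · simpa [h0] using realizable_apply_eq_zero hq
      · rw [he]
        exact realizable_dvd_apply hq e
    have hJb := hbase.forall_mem_dvd J
    rw [Finset.insert_eq_self.mpr hp] at hJb
    choose! e he using fun j (hj : j ∉ J) => (hk j).resolve_left (hJ' j hj)
    have := (hJb.sumRelations_ite hp).sumRelations_mul_pow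
      (fun j => if j ∈ J then 0 else e j) (by simp [hp])
    refine ⟨p, ?_⟩
    convert this using 2
    ext j
    by_cases hj : j ∈ J
    · simp [hj, hJ j hj]
    · simp [hj, he j hj]
  by_cases hz : ∃ p, k p = 0
  · obtain ⟨p, hp⟩ := hz
    exact ⟨p, Finset.univ.filter (k · = 0), by simp [hp], by simp [hp], by simp⟩
  · push Not at hz
    exact ⟨⟨0, by omega⟩, {⟨0, by omega⟩}, by simp, by simp, fun j _ => hz j⟩

end AbelianStep

theorem binTreeAut_pow_apply (g : ↥binTreeAut) (w : List Bool) :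
    ((g ^ 2 ^ w.length : ↥binTreeAut) : Equiv.Perm (List Bool)) w = w := by
  induction w using List.reverseRecOn with
  | nil => exact (g ^ 2 ^ 0).2.1
  | append_singleton w c ih =>
    rw [List.length_append, List.length_singleton, pow_succ, pow_mul, sq]
    set h := g ^ 2 ^ w.length
    obtain ⟨d, hd⟩ := h.2.2 w c
    obtain ⟨d', hd'⟩ := h.2.2 w d
    rw [ih] at hd hd'
    rw [Subgroup.coe_mul, Equiv.Perm.mul_apply, hd, hd']
    rcases eq_or_ne d c with rfl | hdc
    · rw [← hd', hd]
    rcases eq_or_ne d' d with rfl | hdd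
    · have := (h : Equiv.Perm (List Bool)).injective (hd.trans hd'.symm)
      simp_all
    · congr 2
      revert hdc hdd
      cases c <;> cases d <;> cases d' <;> simp

theorem binTreeAut_orderOf_eq_two_pow {g : ↥binTreeAut} (hg : IsOfFinOrder g) :
    ∃ k, orderOf g = 2 ^ k := by
  obtain ⟨k, m, hm, hord⟩ := Nat.exists_eq_two_pow_mul_odd hg.orderOf_pos.ne'
  have hone : g ^ 2 ^ k = 1 := by
    have hpow : (g ^ 2 ^ k) ^ m = 1 := by rw [← pow_mul, ← hord, pow_orderOf_eq_one]
    ext w : 2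
    have h1 := Function.IsPeriodicPt.gcd (f := ((g ^ 2 ^ k : ↥binTreeAut) : Equiv.Perm _))
      (x := w) (m := m) (n := 2 ^ w.length)
      (by
        rw [Function.IsPeriodicPt, Function.IsFixedPt, ← Equiv.Perm.coe_pow, ← Subgroup.coe_pow,
          hpow]
        rfl)
      (by
        rw [Function.IsPeriodicPt, Function.IsFixedPt, ← Equiv.Perm.coe_pow, ← Subgroup.coe_pow]
        exact binTreeAut_pow_apply _ w)
    rw [Nat.Coprime.pow_right _ hm.coprime_two_right] at h1
    exact h1
  exact ((Nat.dvd_prime_pow Nat.prime_two).mp (orderOf_dvd_of_pow_eq_one hone)).imp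
    fun _ h => h.2

/-- An integer lattice is described by divisibility conditions in a suitable basis. -/
theorem exists_basis_mem_iff_dvd {n : ℕ} (N : Submodule ℤ (Fin n → ℤ)) :
    ∃ (b : Module.Basis (Fin n) ℤ (Fin n → ℤ)) (k : Fin n → ℕ),
      ∀ x, x ∈ N ↔ ∀ j, (k j : ℤ) ∣ b.repr x j := by
  classical
  obtain ⟨r, snf⟩ := N.smithNormalForm (Pi.basisFun ℤ (Fin n))
  have hk : ∀ j, ∃ k : ℕ, (∀ i, snf.f i = j → k = (snf.a i).natAbs) ∧
      (j ∉ Set.range snf.f → k = 0) := by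
    intro j
    by_cases hj : j ∈ Set.range snf.f
    · obtain ⟨i, rfl⟩ := hj
      exact ⟨(snf.a i).natAbs, fun i' h => by rw [snf.f.injective h], fun h => (h ⟨i, rfl⟩).elim⟩
    · exact ⟨0, fun i h => (hj ⟨i, h⟩).elim, fun _ => rfl⟩
  choose k hk hk' using hk
  refine ⟨snf.bM, k, fun x => ⟨fun hx j => ?_, fun hx => ?_⟩⟩
  · by_cases hj : j ∈ Set.range snf.f
    · obtain ⟨i, rfl⟩ := hj
      rw [hk _ i rfl, Int.natAbs_dvd, snf.repr_apply_embedding_eq_repr_smul ⟨x, hx⟩, map_smul]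
      exact Dvd.intro _ rfl
    · rw [snf.repr_eq_zero_of_notMem_range ⟨x, hx⟩ hj]
      exact dvd_zero _
  · rw [← snf.bM.sum_repr x]
    refine Submodule.sum_mem _ fun j _ => ?_
    by_cases hj : j ∈ Set.range snf.f
    · obtain ⟨i, rfl⟩ := hj
      obtain ⟨c, hc⟩ := Int.natAbs_dvd.mp (hk _ i rfl ▸ hx (snf.f i))
      rw [hc, mul_comm, mul_smul, ← snf.snf]
      exact N.smul_mem _ (snf.bN i).2
    · have h0 := hx j
      rw [hk' j hj, Nat.cast_zero, zero_dvd_iff] at h0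
      rw [h0, zero_smul]
      exact N.zero_mem

theorem exists_surjective_eq_zero_iff_dvd {n : ℕ} (G : Type*) [CommGroup G] [Group.FG G]
    (hG : Group.rank G ≤ n) : ∃ (L : (Fin n → ℤ) →ₗ[ℤ] Additive G) (k : Fin n → ℕ),
      Function.Surjective L ∧ ∀ y, L y = 0 ↔ ∀ j, (k j : ℤ) ∣ y j := by
  classical
  obtain ⟨s, hs, hclosure⟩ := Group.rank_spec G
  obtain ⟨v, hv⟩ : ∃ v : Fin n → G, (s : Set G) ⊆ Set.range v := by
    obtain ⟨i⟩ : Nonempty (s ↪ Fin n) :=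
      Function.Embedding.nonempty_of_card_le (by simpa [hs] using hG)
    refine ⟨Function.extend i (fun x => (x : G)) 1, fun x hx => ⟨i ⟨x, hx⟩, ?_⟩⟩
    rw [i.injective.extend_apply]
  let L₀ : (Fin n → ℤ) →ₗ[ℤ] Additive G :=
    Fintype.linearCombination ℤ (fun j => Additive.ofMul (v j))
  have hL₀ : Function.Surjective L₀ := by
    have hle : Subgroup.closure (s : Set G) ≤
        AddSubgroup.toSubgroup' (LinearMap.range L₀).toAddSubgroup := by
      rw [Subgroup.closure_le]
      intro x hx
      obtain ⟨j, rfl⟩ := hv hx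
      exact ⟨Pi.single j 1,
        (Fintype.linearCombination_apply_single ℤ _ j 1).trans (one_smul ℤ _)⟩
    intro x
    exact hle (hclosure ▸ Subgroup.mem_top x.toMul)
  obtain ⟨b, k, hbk⟩ := exists_basis_mem_iff_dvd (LinearMap.ker L₀)
  refine ⟨L₀ ∘ₗ b.equivFun.symm.toLinearMap, k, hL₀.comp b.equivFun.symm.surjective, fun y => ?_⟩
  have := hbk (b.equivFun.symm y)
  rw [LinearMap.mem_ker] at this
  rw [LinearMap.comp_apply, LinearEquiv.coe_coe, this]
  simp only [← b.equivFun_apply, LinearEquiv.apply_symm_apply]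

/-- The shear of `ℤⁿ` replacing the `p`-th coordinate by the sum of all coordinates. -/
def sumShear {n : ℕ} (p : Fin n) : (Fin n → ℤ) →ₗ[ℤ] (Fin n → ℤ) where
  toFun x := Function.update x p (∑ j, x j)
  map_add' x y := by
    ext j
    rcases eq_or_ne j p with rfl | hj <;> simp [Finset.sum_add_distrib, *]
  map_smul' c x := by
    ext j
    rcases eq_or_ne j p with rfl | hj <;> simp [Finset.mul_sum, *]

theorem sumShear_surjective {n : ℕ} (p : Fin n) : Function.Surjective (sumShear p) := by
  intro y
  refine ⟨Function.update y p (y p - ∑ j ∈ Finset.univ.erase p, y j), ?_⟩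
  ext j
  rcases eq_or_ne j p with rfl | hj
  · simp [sumShear, Finset.sum_update_of_mem, Finset.sdiff_singleton_eq_erase]
  · simp [sumShear, hj]

theorem sumShear_dvd_iff {n : ℕ} (p : Fin n) (k : Fin n → ℕ) (x : Fin n → ℤ) :
    (∀ j, (k j : ℤ) ∣ sumShear p x j) ↔ x ∈ AbelianStep.sumRelations p k := by
  constructor
  · intro h
    exact ⟨by simpa [sumShear] using h p, fun j hj => by simpa [sumShear, hj] using h j⟩
  · rintro ⟨h1, h2⟩ j
    rcases eq_or_ne j p with rfl | hj
    · simpa [sumShear] using h1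
    · simpa [sumShear, hj] using h2 j hj

/-- For `n > 1`, a finitely generated abelian group `G` is isomorphic to the
group generated by some invertible `n`-state time-varying automaton over the binary alphabet
if and only if `G` has rank at most `n` and the torsion part of `G` is a 2-group (i.e. every
element of finite order has order a power of two). -/
theorem tva_abelian_classification (n : ℕ) (hn : 1 < n)
    (G : Type) [CommGroup G] [Group.FG G] :
    (∃ (A : TVAutomaton (Fin n)) (h : A.Invertible), Nonempty (G ≃* A.genGroup h)) ↔
      (Group.rank G ≤ n ∧ ∀ g : G, IsOfFinOrder g → ∃ k : ℕ, orderOf g = 2 ^ k) := by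
  constructor
  · rintro ⟨A, h, ⟨e⟩⟩
    constructor
    · have : Group.FG (A.genGroup h) := Group.fg_of_surjective (f := e.toMonoidHom) e.surjective
      rw [Group.rank_congr e]
      calc Group.rank (A.genGroup h)
          ≤ Nat.card (Set.range fun q => A.toAut h 0 q) :=
            Subgroup.rank_closure_finite_le_nat_card _
        _ ≤ Nat.card (Fin n) := Finite.card_range_le _
        _ = n := Nat.card_fin n
    · intro g hg
      have hinj : Function.Injective ((A.genGroup h).subtype.comp e.toMonoidHom) :=
        (A.genGroup h).subtype_injective.comp e.injective
      rw [← orderOf_injective _ hinj]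
      exact binTreeAut_orderOf_eq_two_pow (MonoidHom.isOfFinOrder _ hg)
  · rintro ⟨hrank, htors⟩
    obtain ⟨L, k, hL, hker⟩ := exists_surjective_eq_zero_iff_dvd G hrank
    have hk : ∀ j, k j = 0 ∨ ∃ e, k j = 2 ^ e := by
      intro j
      have hdvd : ∀ m : ℕ, (L (Pi.single j 1)).toMul ^ m = 1 ↔ k j ∣ m := by
        intro m
        rw [← toMul_nsmul, toMul_eq_one, ← map_nsmul, hker]
        constructor
        · intro h
          simpa [Int.natCast_dvd_natCast] using h j
        · intro h i
          rcases eq_or_ne i j with rfl | hij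
          · simpa [Int.natCast_dvd_natCast] using h
          · simp [hij]
      have hord : orderOf (L (Pi.single j 1)).toMul = k j :=
        Nat.dvd_antisymm (orderOf_dvd_of_pow_eq_one ((hdvd _).mpr dvd_rfl))
          ((hdvd _).mp (pow_orderOf_eq_one _))
      rcases Nat.eq_zero_or_pos (k j) with h0 | hpos
      · exact Or.inl h0
      · rw [← hord] at hpos ⊢
        exact Or.inr (htors _ (orderOf_pos_iff.mp hpos))
    obtain ⟨p, hp⟩ := AbelianStep.exists_realizable_sumRelations hn k hk
    refine hp.exists_mulEquiv
      (AddMonoidHom.toMultiplicativeLeft (L ∘ₗ sumShear p).toAddMonoidHom)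
      (hL.comp (sumShear_surjective p)) fun x => ?_
    rw [← sumShear_dvd_iff, ← hker]
    rfl
end

section
/- Let n ≥ 1. An abelian group G is isomorphic to the group G(A) generated by some invertible n-state Mealy automaton A over the binary alphabet {0,1} if and only if G is a free abelian group of rank at most n−1 or an elementary abelian 2-group of rank at most n. -/
/-- A faithful self-similar action of a commutative group `G` on the binary tree: `active g`
tells whether `g` swaps the two subtrees of the root, and `sec g x` is the section of `g`
at the letter `x`. -/
structure SelfSimilarCocycle (G : Type*) [CommGroup G] where
  active : G → Bool
  sec : G → Bool → G
  active_mul : ∀ g h, active (g * h) = xor (active g) (active h)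
  sec_mul : ∀ g h x, sec (g * h) x = sec g (xor (active h) x) * sec h x
  faithful : ∀ P : G → Prop, (∀ g, P g → active g = false ∧ ∀ x, P (sec g x)) →
    ∀ g, P g → g = 1

namespace SelfSimilarCocycle

variable {G : Type*} [CommGroup G] (S : SelfSimilarCocycle G)

theorem active_one : S.active 1 = false := by
  simpa using S.active_mul 1 1

theorem sec_one (x : Bool) : S.sec 1 x = 1 := by
  simpa [S.active_one] using S.sec_mul 1 1 x

theorem active_pow_of_odd (g : G) {k : ℕ} (hk : Odd k) : S.active (g ^ k) = S.active g := by
  obtain ⟨j, rfl⟩ := hk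
  have h : S.active (g ^ j * g ^ j) = false := by rw [S.active_mul, Bool.xor_self]
  rw [pow_succ, two_mul, pow_add, S.active_mul, h, Bool.false_xor]

theorem sec_pow_of_inactive {g : G} (hg : S.active g = false) (k : ℕ) (x : Bool) :
    S.sec (g ^ k) x = S.sec g x ^ k := by
  induction k with
  | zero => simp [S.sec_one]
  | succ k ih => rw [pow_succ, S.sec_mul, hg, Bool.false_xor, ih, pow_succ]

theorem sec_swap {a b : G} (ha : S.active a = true) (hb : S.active b = false) :
    S.sec b false = S.sec b true := by
  have h := S.sec_mul a b false
  rw [mul_comm a b, S.sec_mul, ha, hb] at h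
  simp only [Bool.true_xor, Bool.false_xor, Bool.not_false] at h
  rw [mul_comm (S.sec a false)] at h
  exact (mul_right_cancel h).symm

/-- The product of the two first-level sections. -/
def secProd : G →* G where
  toFun g := S.sec g false * S.sec g true
  map_one' := by simp [S.sec_one]
  map_mul' g h := by
    simp only [S.sec_mul]
    cases S.active h
    · simp only [Bool.false_xor]; exact mul_mul_mul_comm _ _ _ _
    · simp only [Bool.true_xor, Bool.not_false, Bool.not_true]
      rw [mul_mul_mul_comm, mul_comm (S.sec g true)]

theorem secProd_apply (g : G) : S.secProd g = S.sec g false * S.sec g true := rfl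

theorem active_sq (g : G) : S.active (g ^ 2) = false := by
  rw [sq, S.active_mul, Bool.xor_self]

theorem sec_sq {a : G} (ha : S.active a = true) (g : G) (x : Bool) :
    S.sec (g ^ 2) x = S.secProd g := by
  rw [sq, S.sec_mul, secProd_apply]
  cases hg : S.active g
  · have h := S.sec_swap ha hg
    cases x <;> simp [h]
  · cases x
    · exact mul_comm _ _
    · rfl

theorem sq_eq_one_of_involution {a t : G} (ha : S.active a = true) (ht : t ≠ 1)
    (ht2 : t ^ 2 = 1) (c : G) : c ^ 2 = 1 := by
  obtain ⟨b, hb, hb2⟩ : ∃ b, S.active b = true ∧ b ^ 2 = 1 := by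
    by_contra hcon
    push Not at hcon
    refine ht (S.faithful (fun g => g ^ 2 = 1) (fun g hg => ?_) t ht2)
    have hg0 : S.active g = false := by
      by_contra hne
      exact hcon g (by simpa using hne) hg
    exact ⟨hg0, fun x => by rw [← S.sec_pow_of_inactive hg0, hg, S.sec_one]⟩
  have hbprod : S.sec b false * S.sec b true = 1 := by
    rw [← secProd_apply, ← S.sec_sq ha b false, hb2, S.sec_one]
  refine S.faithful (fun g => ∃ c, g = c ^ 2) ?_ _ ⟨c, rfl⟩
  rintro _ ⟨c, rfl⟩
  refine ⟨S.active_sq c, fun x => ?_⟩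
  cases hc : S.active c
  · exact ⟨S.sec c x, S.sec_pow_of_inactive hc 2 x⟩
  · refine ⟨S.sec c false * (S.sec b false)⁻¹, ?_⟩
    have h := S.sec_mul b c false
    rw [mul_comm b c, S.sec_mul, hb, hc] at h
    simp only [Bool.true_xor, Bool.not_false] at h
    rw [S.sec_sq ha, secProd_apply, eq_mul_inv_of_mul_eq h, eq_inv_of_mul_eq_one_right hbprod]
    simp only [sq]
    ac_rfl

theorem isMulTorsionFree {G : Type*} [CommGroup G] (S : SelfSimilarCocycle G)
    (hsq : ∀ t : G, t ^ 2 = 1 → t = 1) :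
    IsMulTorsionFree G := by
  have key : ∀ k : ℕ, k ≠ 0 → ∀ g : G, g ^ k = 1 → g = 1 := by
    intro k
    induction k using Nat.strong_induction_on with
    | _ k ih =>
      intro hk g hg
      rcases Nat.even_or_odd k with ⟨j, rfl⟩ | hodd
      · refine ih j (by omega) (by omega) g (hsq _ ?_)
        rw [← pow_mul, mul_two, hg]
      · refine S.faithful (fun g => g ^ k = 1) (fun g hg => ?_) g hg
        have hg0 : S.active g = false := by
          rw [← S.active_pow_of_odd g hodd, hg, S.active_one]
        exact ⟨hg0, fun x => by rw [← S.sec_pow_of_inactive hg0, hg, S.sec_one]⟩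
  refine ⟨fun k hk g h hgh => ?_⟩
  have := key k hk (g / h) (by rw [div_pow]; exact div_eq_one.2 hgh)
  exact div_eq_one.1 this

end SelfSimilarCocycle

/-- A matrix over `ℤ` whose columns each have exactly two unit entries (counted with
multiplicity) has eigenvalue `2`. -/
theorem exists_eigenvector_two {Q : Type*} [Fintype Q] [DecidableEq Q] [Nonempty Q]
    (φ : Q → Bool → Q) :
    ∃ v : Q → ℤ, v ≠ 0 ∧ ∑ q, v q • (Pi.single (φ q false) 1 + Pi.single (φ q true) 1 : Q → ℤ)
      = (2 : ℤ) • v := by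
  let N : Matrix Q Q ℤ := Matrix.of fun r q =>
    (Pi.single (φ q false) 1 + Pi.single (φ q true) 1 - 2 • Pi.single q 1 : Q → ℤ) r
  have hdet : N.det = 0 := by
    rw [← Matrix.exists_vecMul_eq_zero_iff]
    refine ⟨fun _ => 1, fun h => one_ne_zero (congrFun h (Classical.arbitrary Q)), ?_⟩
    ext q
    simp [N, Matrix.vecMul, dotProduct, Finset.sum_add_distrib, Finset.sum_sub_distrib,
      ← Finset.mul_sum, Finset.sum_pi_single']
  obtain ⟨v, hv, hNv⟩ := Matrix.exists_mulVec_eq_zero_iff.2 hdet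
  refine ⟨v, hv, ?_⟩
  ext r
  have h := congrFun hNv r
  simp only [Matrix.mulVec, dotProduct, N, Matrix.of_apply, Pi.sub_apply, Pi.add_apply,
    Pi.smul_apply, sub_mul, Finset.sum_sub_distrib, Pi.zero_apply, sub_eq_zero] at h
  simp only [Finset.sum_apply, Pi.smul_apply, Pi.add_apply, smul_eq_mul]
  calc _ = _ := Finset.sum_congr rfl fun q _ => mul_comm _ _
    _ = _ := h
    _ = _ := by simp [Pi.single_apply]

theorem span_range_ofMul_eq_top (R : Type*) {ι G : Type*} [Ring R] [CommGroup G]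
    [Module R (Additive G)] {γ : ι → G} (hγ : Subgroup.closure (Set.range γ) = ⊤) :
    Submodule.span R (Set.range fun q => Additive.ofMul (γ q)) = ⊤ := by
  refine Submodule.eq_top_iff'.2 fun g => ?_
  obtain ⟨g, rfl⟩ := Additive.ofMul.surjective g
  have hg : g ∈ Subgroup.closure (Set.range γ) := hγ ▸ Subgroup.mem_top _
  induction hg using Subgroup.closure_induction with
  | mem x hx =>
    obtain ⟨q, rfl⟩ := hx
    exact Submodule.subset_span ⟨q, rfl⟩
  | one => exact Submodule.zero_mem _
  | mul x y _ _ hx hy => exact Submodule.add_mem _ hx hy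
  | inv x _ hx => exact Submodule.neg_mem _ hx

namespace SelfSimilarCocycle

variable {G : Type*} [CommGroup G] (S : SelfSimilarCocycle G)

theorem exists_relation {a : G} (ha : S.active a = true) [IsMulTorsionFree G] {n : ℕ}
    [NeZero n] (γ : Fin n → G) (φ : Fin n → Bool → Fin n)
    (hφ : ∀ q x, S.sec (γ q) x = γ (φ q x)) :
    ∃ v : Fin n → ℤ, v ≠ 0 ∧
      Fintype.linearCombination ℤ (fun q => Additive.ofMul (γ q)) v = 0 := by
  obtain ⟨v, hv, hv2⟩ := exists_eigenvector_two φ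
  refine ⟨v, hv, ?_⟩
  set L := Fintype.linearCombination ℤ (fun q => Additive.ofMul (γ q)) with hL
  have hsingle (q) : L (Pi.single q 1) = Additive.ofMul (γ q) := by
    simp [hL, Fintype.linearCombination_apply_single]
  have hprod : S.secProd (L v).toMul = (L v).toMul ^ 2 := by
    apply Additive.ofMul.injective
    change S.secProd.toAdditive (L v) = (2 : ℕ) • L v
    have h2 := congrArg L hv2
    simp only [map_sum, map_smul, map_add, hsingle] at h2
    rw [ofNat_zsmul] at h2
    rw [← h2, hL, Fintype.linearCombination_apply, map_sum]
    refine Finset.sum_congr rfl fun q _ => ?_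
    rw [map_zsmul]
    congr 1
    change Additive.ofMul (S.secProd (γ q)) = _
    rw [secProd_apply, hφ, hφ, ofMul_mul]
  have hone : (L v).toMul ^ 2 = 1 := by
    refine S.faithful (fun g => g = (L v).toMul ^ 2) ?_ _ rfl
    rintro _ rfl
    exact ⟨S.active_sq _, fun x => by rw [S.sec_sq ha, hprod]⟩
  exact Additive.toMul.injective ((pow_eq_one_iff_left (M := G) two_ne_zero).1 hone)

theorem classification {n : ℕ} [NeZero n] (γ : Fin n → G)
    (hγ : Subgroup.closure (Set.range γ) = ⊤)
    (φ : Fin n → Bool → Fin n) (hφ : ∀ q x, S.sec (γ q) x = γ (φ q x)) :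
    (∃ m : ℕ, m ≤ n - 1 ∧ Nonempty (G ≃* Multiplicative (Fin m → ℤ))) ∨
      (∃ m : ℕ, m ≤ n ∧ Nonempty (G ≃* Multiplicative (Fin m → ZMod 2))) := by
  by_cases hact : ∃ a, S.active a = true
  · obtain ⟨a, ha⟩ := hact
    by_cases hsq : ∀ t : G, t ^ 2 = 1 → t = 1
    · left
      have := S.isMulTorsionFree hsq
      have hspan := span_range_ofMul_eq_top ℤ hγ
      have : Module.Finite ℤ (Additive G) := ⟨hspan ▸ Submodule.fg_span (Set.finite_range _)⟩
      obtain ⟨v, hv, hLv⟩ := S.exists_relation ha γ φ hφ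
      set L := Fintype.linearCombination ℤ (fun q => Additive.ofMul (γ q)) with hL
      have hrange : LinearMap.range L = ⊤ := by
        rw [hL, Fintype.range_linearCombination, hspan]
      have hrn := (LinearMap.ker L).finrank_quotient_add_finrank
      rw [L.quotKerEquivRange.finrank_eq, hrange, finrank_top, Module.finrank_fin_fun] at hrn
      have : Nontrivial (LinearMap.ker L) :=
        ⟨⟨⟨v, hLv⟩, 0, fun h => hv (congrArg Subtype.val h)⟩⟩
      have hker : 0 < Module.finrank ℤ (LinearMap.ker L) := Module.finrank_pos
      exact ⟨Module.finrank ℤ (Additive G), by omega,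
        ⟨AddEquiv.toMultiplicativeRight (Module.finBasis ℤ (Additive G)).equivFun.toAddEquiv⟩⟩
    · right
      push Not at hsq
      obtain ⟨t, ht2, ht⟩ := hsq
      have htwo := S.sq_eq_one_of_involution ha ht ht2
      let : Module (ZMod 2) (Additive G) := AddCommGroup.zmodModule htwo
      have hspan := span_range_ofMul_eq_top (ZMod 2) hγ
      have : Module.Finite (ZMod 2) (Additive G) :=
        ⟨hspan ▸ Submodule.fg_span (Set.finite_range _)⟩
      have hle := finrank_range_le_card (R := ZMod 2) (fun q => Additive.ofMul (γ q))
      rw [Set.finrank, hspan, finrank_top, Fintype.card_fin] at hle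
      exact ⟨Module.finrank (ZMod 2) (Additive G), hle,
        ⟨AddEquiv.toMultiplicativeRight
          (Module.finBasis (ZMod 2) (Additive G)).equivFun.toAddEquiv⟩⟩
  · left
    have htriv : ∀ g : G, g = 1 := fun g => S.faithful (fun _ => True)
      (fun g _ => ⟨by simpa using fun h => hact ⟨g, h⟩, fun _ => trivial⟩) g trivial
    have : Unique G := ⟨⟨1⟩, htriv⟩
    exact ⟨0, Nat.zero_le _, ⟨MulEquiv.ofUnique⟩⟩

end SelfSimilarCocycle

namespace TVAutomaton

theorem act_eq_act_zero_of_isMealy {Q : Type*} {A : TVAutomaton Q} (hA : A.IsMealy) :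
    ∀ (w : List Bool) (i : ℕ) (q : Q), A.act i q w = A.act 0 q w
  | [], _, _ => rfl
  | x :: w, i, q => by
    rw [act, act, act_eq_act_zero_of_isMealy hA w (i + 1), act_eq_act_zero_of_isMealy hA w (0 + 1),
      (hA i).1, (hA i).2]

theorem psi_eq_xor {Q : Type*} {A : TVAutomaton Q} (h : A.Invertible) (i : ℕ) (q : Q)
    (x : Bool) : A.psi i q x = xor (A.psi i q false) x := by
  have hne : A.psi i q true ≠ A.psi i q false := fun he => by simpa using (h i q).1 he
  cases x
  · simp
  · simpa using Bool.eq_not.2 hne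

/-- Every element of the group of an invertible Mealy automaton decomposes on the first level,
with sections in the same group. -/
theorem exists_sections {Q : Type*} {A : TVAutomaton Q} (h : A.Invertible) (hA : A.IsMealy)
    (g : A.genGroup h) :
    ∃ (e : Bool) (s : Bool → A.genGroup h), ∀ x w,
      (g : ↥binTreeAut).1 (x :: w) = xor e x :: (s x : ↥binTreeAut).1 w := by
  obtain ⟨g, hg⟩ := g
  induction hg using Subgroup.closure_induction with
  | mem g hg =>
    obtain ⟨q, rfl⟩ := hg
    refine ⟨A.psi 0 q false, fun x => ⟨A.toAut h 0 (A.phi 0 q x),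
      Subgroup.subset_closure ⟨_, rfl⟩⟩, fun x w => ?_⟩
    change A.act 0 q (x :: w) = _ :: A.act 0 _ w
    rw [act, act_eq_act_zero_of_isMealy hA, psi_eq_xor h]
  | one => exact ⟨false, fun _ => 1, fun x w => by simp⟩
  | mul g g' _ _ ih ih' =>
    obtain ⟨e, s, hs⟩ := ih
    obtain ⟨e', s', hs'⟩ := ih'
    refine ⟨xor e e', fun x => s (xor e' x) * s' x, fun x w => ?_⟩
    change g.1 (g'.1 (x :: w)) = _ :: (s (xor e' x)).1.1 ((s' x).1.1 w)
    simp only at hs hs'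
    rw [hs', hs, Bool.xor_assoc]
  | inv g _ ih =>
    obtain ⟨e, s, hs⟩ := ih
    refine ⟨e, fun x => (s (xor e x))⁻¹, fun x w => ?_⟩
    change g.1⁻¹ (x :: w) = _ :: (s (xor e x)).1.1⁻¹ w
    rw [Equiv.Perm.inv_eq_iff_eq]
    simp only at hs
    rw [hs]
    simp

theorem classification_of_mulEquiv {n : ℕ} [NeZero n] {G : Type*} [CommGroup G]
    {A : TVAutomaton (Fin n)} {h : A.Invertible} (hA : A.IsMealy) (F : G ≃* A.genGroup h) :
    (∃ m : ℕ, m ≤ n - 1 ∧ Nonempty (G ≃* Multiplicative (Fin m → ℤ))) ∨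
      (∃ m : ℕ, m ≤ n ∧ Nonempty (G ≃* Multiplicative (Fin m → ZMod 2))) := by
  have hex : ∀ g : G, ∃ (e : Bool) (s : Bool → G), ∀ x w,
      (F g).1.1 (x :: w) = xor e x :: (F (s x)).1.1 w := fun g => by
    obtain ⟨e, s, hs⟩ := exists_sections h hA (F g)
    exact ⟨e, fun x => F.symm (s x), by simpa using hs⟩
  choose e s hs using hex
  have hinj : ∀ {g g' : G}, (∀ w, (F g).1.1 w = (F g').1.1 w) → g = g' := fun hw =>
    F.injective (Subtype.ext (Subtype.ext (Equiv.ext hw)))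
  have hmul : ∀ g g' x w, xor (e (g * g')) x :: (F (s (g * g') x)).1.1 w =
      xor (e g) (xor (e g') x) :: (F (s g (xor (e g') x) * s g' x)).1.1 w := fun g g' x w => by
    rw [← hs, map_mul, map_mul]
    change (F g).1.1 ((F g').1.1 (x :: w)) = _ :: (F (s g (xor (e g') x))).1.1 ((F (s g' x)).1.1 w)
    rw [hs, hs]
  let S : SelfSimilarCocycle G :=
    { active := e
      sec := s
      active_mul := fun g g' => by simpa using (List.cons.inj (hmul g g' false [])).1
      sec_mul := fun g g' x => hinj fun w => (List.cons.inj (hmul g g' x w)).2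
      faithful := fun P hP g hg => hinj fun w => by
        rw [map_one]
        change (F g).1.1 w = w
        induction w generalizing g with
        | nil => exact (F g).1.2.1
        | cons x w ih => rw [hs, (hP g hg).1, ih _ ((hP g hg).2 x), Bool.false_xor] }
  let γ : Fin n → A.genGroup h := fun q => ⟨A.toAut h 0 q, Subgroup.subset_closure ⟨q, rfl⟩⟩
  have hγ : Subgroup.closure (Set.range γ) = ⊤ := by
    have := Subgroup.closure_closure_coe_preimage (k := Set.range fun q => A.toAut h 0 q)
    refine Eq.trans (congrArg Subgroup.closure ?_) this
    ext g
    exact ⟨fun ⟨q, hq⟩ => ⟨q, congrArg Subtype.val hq⟩, fun ⟨q, hq⟩ => ⟨q, Subtype.ext hq⟩⟩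
  refine S.classification (fun q => F.symm (γ q)) ?_ (A.phi 0) fun q x => hinj fun w => ?_
  · rw [Set.range_comp' F.symm γ]
    change Subgroup.closure ((F.symm : A.genGroup h →* G) '' Set.range γ) = ⊤
    rw [← MonoidHom.map_closure, hγ, ← MonoidHom.range_eq_map]
    exact MonoidHom.range_eq_top.2 F.symm.surjective
  · have h1 := hs (F.symm (γ q)) x w
    rw [F.apply_symm_apply] at h1 ⊢
    change A.act 0 q (x :: w) = _ at h1
    change _ = A.act 0 _ w
    rw [act, act_eq_act_zero_of_isMealy hA] at h1
    exact (List.cons.inj h1).2.symm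

end TVAutomaton

/-- A transducer on a coordinate group `M` generated by `1`: an element `a : M` reads a letter
`x`, writes the letter `out a x` and becomes `next a x`.  The norm controls faithfulness. -/
structure DigitAction (M : Type*) [AddCommGroupWithOne M] where
  out : M → Bool → Bool
  next : M → Bool → M
  carry : Bool → Bool
  norm : M → ℕ
  out_zero : ∀ x, out 0 x = x
  next_zero : ∀ x, next 0 x = 0
  out_add : ∀ a b x, out (a + b) x = out a (out b x)
  next_add : ∀ a b x, next (a + b) x = next a (out b x) + next b x
  out_one : ∀ x, out 1 x = !x
  next_one : ∀ x, next 1 x = if carry x then 1 else 0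
  norm_next : ∀ a, a ≠ 0 → out a false = false → next a false ≠ 0 ∧ norm (next a false) < norm a
  closure_one : AddSubgroup.closure {(1 : M)} = ⊤

namespace DigitAction

/-- The binary odometer. -/
def int : DigitAction ℤ where
  out a x := decide ((a + x.toNat) % 2 = 1)
  next a x := (a + x.toNat) / 2
  carry x := x
  norm := Int.natAbs
  out_zero x := by cases x <;> rfl
  next_zero x := by cases x <;> rfl
  out_add a b x := by
    rcases Int.emod_two_eq (b + x.toNat) with h | h <;> simp [h] <;> omega
  next_add a b x := by
    rcases Int.emod_two_eq (b + x.toNat) with h | h <;> simp [h] <;> omega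
  out_one x := by cases x <;> rfl
  next_one x := by cases x <;> rfl
  norm_next a ha h := by
    simp at h ⊢
    omega
  closure_one := Int.addSubgroupClosure_one

/-- The involution that flips letters. -/
def zmodTwo : DigitAction (ZMod 2) where
  out a x := xor (decide (a = 1)) x
  next a _ := a
  carry _ := true
  norm _ := 0
  out_zero := by decide
  next_zero := by decide
  out_add := by decide
  next_add := by decide
  out_one := by decide
  next_one := by decide
  norm_next := by decide
  closure_one := by
    refine eq_top_iff.2 fun a _ => ?_
    have h := AddSubgroup.nsmul_mem (AddSubgroup.closure {(1 : ZMod 2)})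
      (AddSubgroup.subset_closure (Set.mem_singleton _)) a.val
    rwa [nsmul_one, ZMod.natCast_zmod_val] at h

variable {M : Type*} [AddCommGroupWithOne M] (D : DigitAction M) {m : ℕ} [NeZero m]

/-- The action of `M ^ m` on words in which the coordinate `i`, `i + 1`, … (cyclically) reads
the first, second, … letter. -/
def run : Fin m → (Fin m → M) → List Bool → List Bool
  | _, _, [] => []
  | i, v, x :: w => D.out (v i) x :: run (i + 1) (Function.update v i (D.next (v i) x)) w

theorem run_zero (i : Fin m) (w : List Bool) : D.run i 0 w = w := by
  induction w generalizing i with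
  | nil => rfl
  | cons x w ih =>
    have h : Function.update (0 : Fin m → M) i 0 = 0 := Function.update_eq_self i 0
    rw [run, Pi.zero_apply, D.out_zero, D.next_zero, h, ih]

theorem run_add (i : Fin m) (u v : Fin m → M) (w : List Bool) :
    D.run i (u + v) w = D.run i u (D.run i v w) := by
  induction w generalizing i u v with
  | nil => rfl
  | cons x w ih =>
    rw [run, run, run, Pi.add_apply, D.out_add, D.next_add, Function.update_add, ih]

theorem run_concat (i : Fin m) (v : Fin m → M) (w : List Bool) (x : Bool) :
    ∃ y, D.run i v (w ++ [x]) = D.run i v w ++ [y] := by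
  induction w generalizing i v with
  | nil => exact ⟨_, rfl⟩
  | cons a w ih =>
    obtain ⟨y, hy⟩ := ih (i + 1) (Function.update v i (D.next (v i) a))
    exact ⟨y, by rw [List.cons_append, run, hy, run, List.cons_append]⟩

theorem eq_zero_of_run_eq_self (i : Fin m) (v : Fin m → M) (h : ∀ w, D.run i v w = w) :
    v = 0 := by
  induction hN : ∑ j, D.norm (v j) using Nat.strong_induction_on generalizing i v with
  | _ N ih =>
    subst hN
    have step : ∀ j, (∀ w, D.run j v w = w) → v j = 0 ∧ ∀ w, D.run (j + 1) v w = w := by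
      intro j hj
      have hout : D.out (v j) false = false := (List.cons.inj (hj [false])).1
      have hrun (w) : D.run (j + 1) (Function.update v j (D.next (v j) false)) w = w :=
        (List.cons.inj (hj (false :: w))).2
      have hvj : v j = 0 := by
        by_contra hne
        obtain ⟨hnext, hlt⟩ := D.norm_next _ hne hout
        have h0 := ih _ ?_ _ _ hrun rfl
        · exact hnext (by simpa using congrFun h0 j)
        · refine Finset.sum_lt_sum (fun k _ => ?_) ⟨j, Finset.mem_univ j, by simpa using hlt⟩
          rcases eq_or_ne k j with rfl | hk
          · simpa using hlt.le
          · simp [hk]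
      refine ⟨hvj, fun w => ?_⟩
      have hup : Function.update v j (D.next (v j) false) = v := by
        rw [Function.update_eq_self_iff, hvj, D.next_zero]
      simpa [hup] using hrun w
    have hall : ∀ k : ℕ, ∀ w, D.run (i + Fin.ofNat m k) v w = w := by
      intro k
      induction k with
      | zero => simpa using h
      | succ k ihk =>
        have := (step _ ihk).2
        have hk : i + Fin.ofNat m (k + 1) = i + Fin.ofNat m k + 1 := by
          rw [add_assoc]; congr 1; ext; simp [Fin.val_add]
        rwa [hk]
    funext j
    have := (step _ (hall (j - i).val)).1
    simpa using this

/-- The action of `M ^ m` on the binary tree. -/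
def hom : Multiplicative (Fin m → M) →* ↥binTreeAut where
  toFun v := ⟨⟨D.run 0 v.toAdd, D.run 0 (-v.toAdd),
    fun w => by rw [← D.run_add, neg_add_cancel, D.run_zero],
    fun w => by rw [← D.run_add, add_neg_cancel, D.run_zero]⟩, rfl, D.run_concat 0 v.toAdd⟩
  map_one' := Subtype.ext (Equiv.ext fun w => D.run_zero 0 w)
  map_mul' u v := Subtype.ext (Equiv.ext fun w => D.run_add 0 u.toAdd v.toAdd w)

theorem hom_apply (v : Multiplicative (Fin m → M)) (w : List Bool) :
    (D.hom v).1 w = D.run 0 v.toAdd w := rfl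

theorem hom_injective : Function.Injective (D.hom (m := m)) := by
  refine (injective_iff_map_eq_one _).2 fun v hv => ?_
  refine Multiplicative.toAdd.injective (D.eq_zero_of_run_eq_self 0 v.toAdd fun w => ?_)
  rw [← hom_apply, hv]
  rfl

theorem closure_single {M : Type*} [AddCommGroupWithOne M] (D : DigitAction M) {m : ℕ} :
    Subgroup.closure (Set.range fun k : Fin m => Multiplicative.ofAdd (Pi.single k (1 : M))) =
      ⊤ := by
  refine eq_top_iff.2 fun v _ => ?_
  have hcoord : ∀ (k : Fin m) (a : M), Multiplicative.ofAdd (Pi.single k a) ∈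
      Subgroup.closure (Set.range fun k : Fin m => Multiplicative.ofAdd (Pi.single k (1 : M))) := by
    intro k a
    have ha : a ∈ AddSubgroup.closure {(1 : M)} := D.closure_one ▸ AddSubgroup.mem_top a
    induction ha using AddSubgroup.closure_induction with
    | mem a ha => exact Subgroup.subset_closure ⟨k, by rw [Set.mem_singleton_iff.1 ha]⟩
    | zero => rw [Pi.single_zero]; exact Subgroup.one_mem _
    | add a b _ _ ha hb => rw [Pi.single_add]; exact Subgroup.mul_mem _ ha hb
    | neg a _ ha => rw [Pi.single_neg]; exact Subgroup.inv_mem _ ha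
  have hv : v = ∏ k, Multiplicative.ofAdd (Pi.single k (v.toAdd k)) := by
    apply Multiplicative.toAdd.injective
    rw [toAdd_prod]
    exact (Finset.univ_sum_single v.toAdd).symm
  rw [hv]
  exact Subgroup.prod_mem _ fun k _ => hcoord k _

/-- The Mealy automaton with states `0, …, n - 1` in which the states below `m` generate the
action of `M ^ m` and the remaining ones are trivial. -/
def automaton (n m : ℕ) [NeZero n] : TVAutomaton (Fin n) where
  phi _ q x := if m ≤ q.val then q else if q.val = 0 then
    (if D.carry x then Fin.ofNat n (m - 1) else Fin.ofNat n (n - 1)) else Fin.ofNat n (q.val - 1)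
  psi _ q x := xor (decide (q.val < m ∧ q.val = 0)) x

theorem automaton_invertible (n m : ℕ) [NeZero n] : (D.automaton n m).Invertible := fun _ _ =>
  Function.Involutive.bijective fun _ => by simp [automaton]

theorem automaton_isMealy (n m : ℕ) [NeZero n] : (D.automaton n m).IsMealy := fun _ =>
  ⟨rfl, rfl⟩

theorem automaton_act_of_le {n m : ℕ} [NeZero n] (t : ℕ) (q : Fin n) (hq : m ≤ q.val)
    (w : List Bool) : (D.automaton n m).act t q w = w := by
  induction w generalizing t with
  | nil => rfl
  | cons x w ih =>
    have hphi : (D.automaton n m).phi t q x = q := if_pos hq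
    have hpsi : (D.automaton n m).psi t q x = x := by simp [automaton, hq.not_gt]
    rw [TVAutomaton.act, hphi, hpsi, ih]

theorem automaton_act_of_lt {n : ℕ} [NeZero n] (hmn : m ≤ n)
    (hcarry : (∃ x, D.carry x = false) → m ≤ n - 1) (t : ℕ) (q : Fin n) (hq : q.val < m)
    (i : Fin m) (w : List Bool) :
    (D.automaton n m).act t q w = D.run i (Pi.single (i + Fin.ofNat m q.val) 1) w := by
  induction w generalizing t q i with
  | nil => rfl
  | cons x w ih =>
    have hn0 : 0 < n := NeZero.pos n
    have hm0 : 0 < m := NeZero.pos m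
    rw [TVAutomaton.act, run]
    by_cases hq0 : q.val = 0
    · have hi : i + Fin.ofNat m q.val = i := by
        simp [hq0]
      have hpsi : (D.automaton n m).psi t q x = !x := by
        change xor (decide (q.val < m ∧ q.val = 0)) x = _
        rw [decide_eq_true ⟨hq, hq0⟩, Bool.true_xor]
      rw [hi, Pi.single_eq_same, D.out_one, D.next_one, hpsi]
      congr 1
      cases hx : D.carry x
      · have hlast : m ≤ (Fin.ofNat n (n - 1)).val := by
          rw [Fin.val_ofNat, Nat.mod_eq_of_lt (by omega)]
          exact hcarry ⟨x, hx⟩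
        have hphi : (D.automaton n m).phi t q x = Fin.ofNat n (n - 1) := by
          change ite _ _ _ = _
          rw [if_neg hq.not_ge, if_pos hq0, hx]
          rfl
        have hup : Function.update (Pi.single i 1 : Fin m → M) i 0 = 0 := by
          rw [Pi.single, Function.update_idem]
          exact Function.update_eq_self i 0
        rw [hphi, D.automaton_act_of_le _ _ hlast, if_neg (by simp), hup, D.run_zero]
      · have hval : (Fin.ofNat n (m - 1)).val = m - 1 := by
          rw [Fin.val_ofNat, Nat.mod_eq_of_lt (by omega)]
        have hphi : (D.automaton n m).phi t q x = Fin.ofNat n (m - 1) := by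
          change ite _ _ _ = _
          rw [if_neg hq.not_ge, if_pos hq0, hx]
          rfl
        have hup : Function.update (Pi.single i 1 : Fin m → M) i 1 = Pi.single i 1 := by
          rw [Pi.single, Function.update_idem]
        have hi' : i + 1 + Fin.ofNat m (m - 1) = i := by
          rw [add_assoc]
          refine (add_eq_left).2 ?_
          ext
          simp [Fin.val_add, Nat.add_sub_cancel' hm0]
        rw [hphi, ih _ _ (by omega) (i + 1), hval, hi', if_pos rfl, hup]
    · have hval : (Fin.ofNat n (q.val - 1)).val = q.val - 1 := by
        rw [Fin.val_ofNat, Nat.mod_eq_of_lt (by omega)]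
      have hne : i ≠ i + Fin.ofNat m q.val := by
        intro h
        have h0 := congrArg Fin.val (left_eq_add.1 h)
        rw [Fin.val_ofNat, Nat.mod_eq_of_lt hq] at h0
        exact hq0 (by simpa using h0)
      have hpsi : (D.automaton n m).psi t q x = x := by
        change xor (decide (q.val < m ∧ q.val = 0)) x = _
        rw [decide_eq_false fun h => hq0 h.2, Bool.false_xor]
      have hphi : (D.automaton n m).phi t q x = Fin.ofNat n (q.val - 1) := by
        change ite _ _ _ = _
        rw [if_neg hq.not_ge, if_neg hq0]
      have hi' : i + 1 + Fin.ofNat m (q.val - 1) = i + Fin.ofNat m q.val := by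
        rw [add_assoc]
        congr 1
        ext
        simp [Fin.val_add, Nat.add_sub_cancel' (Nat.pos_of_ne_zero hq0)]
      have hup : Function.update (Pi.single (i + Fin.ofNat m q.val) 1 : Fin m → M) i 0 =
          Pi.single (i + Fin.ofNat m q.val) 1 := by
        rw [Function.update_eq_self_iff, Pi.single_eq_of_ne hne]
      rw [hphi, hpsi, ih _ _ (by omega) (i + 1), hval, hi', Pi.single_eq_of_ne hne, D.out_zero,
        D.next_zero, hup]

theorem genGroup_automaton {n : ℕ} [NeZero n] (hmn : m ≤ n)
    (hcarry : (∃ x, D.carry x = false) → m ≤ n - 1) :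
    (D.automaton n m).genGroup (D.automaton_invertible n m) = (D.hom (m := m)).range := by
  have hgen (q : Fin n) (hq : q.val < m) :
      (D.automaton n m).toAut (D.automaton_invertible n m) 0 q =
        D.hom (Multiplicative.ofAdd (Pi.single (Fin.ofNat m q.val) 1)) := by
    refine Subtype.ext (Equiv.ext fun w => ?_)
    have h := D.automaton_act_of_lt hmn hcarry 0 q hq 0 w
    rwa [zero_add] at h
  apply le_antisymm
  · refine (Subgroup.closure_le _).2 ?_
    rintro _ ⟨q, rfl⟩
    rcases lt_or_ge q.val m with hq | hq
    · exact ⟨_, (hgen q hq).symm⟩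
    · refine ⟨1, ?_⟩
      rw [map_one]
      exact Subtype.ext (Equiv.ext fun w => (D.automaton_act_of_le 0 q hq w).symm)
  · rw [MonoidHom.range_eq_map, ← D.closure_single, MonoidHom.map_closure,
      Subgroup.closure_le]
    rintro _ ⟨_, ⟨k, rfl⟩, rfl⟩
    refine Subgroup.subset_closure ⟨Fin.castLE hmn k, (hgen _ k.isLt).trans ?_⟩
    simp

theorem genGroup_automaton_zero (n : ℕ) [NeZero n] :
    (D.automaton n 0).genGroup (D.automaton_invertible n 0) = ⊥ := by
  refine Subgroup.closure_eq_bot_iff.2 ?_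
  rintro _ ⟨q, rfl⟩
  exact Subtype.ext (Equiv.ext fun w => D.automaton_act_of_le 0 q (Nat.zero_le _) w)

theorem exists_automaton {n : ℕ} [NeZero n] (m : ℕ) (hmn : m ≤ n)
    (hcarry : (∃ x, D.carry x = false) → m ≤ n - 1) {G : Type*} [CommGroup G]
    (F : G ≃* Multiplicative (Fin m → M)) :
    ∃ (A : TVAutomaton (Fin n)) (h : A.Invertible), A.IsMealy ∧ Nonempty (G ≃* A.genGroup h) := by
  refine ⟨D.automaton n m, D.automaton_invertible n m, D.automaton_isMealy n m, ?_⟩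
  rcases Nat.eq_zero_or_pos m with rfl | hm
  · rw [D.genGroup_automaton_zero]
    exact ⟨F.trans MulEquiv.ofUnique⟩
  · have : NeZero m := ⟨hm.ne'⟩
    rw [D.genGroup_automaton hmn hcarry]
    exact ⟨F.trans (MonoidHom.ofInjective D.hom_injective)⟩

end DigitAction

/-- For `n ≥ 1`, an abelian group `G` is isomorphic to the group generated by
some invertible `n`-state Mealy automaton over the binary alphabet if and only if `G` is a
free abelian group of rank at most `n - 1` or an elementary abelian 2-group of rank at most
`n`. -/
theorem mealy_abelian_classification (n : ℕ) (hn : 1 ≤ n) (G : Type) [CommGroup G] :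
    (∃ (A : TVAutomaton (Fin n)) (h : A.Invertible),
        A.IsMealy ∧ Nonempty (G ≃* A.genGroup h)) ↔
      ((∃ m : ℕ, m ≤ n - 1 ∧ Nonempty (G ≃* Multiplicative (Fin m → ℤ))) ∨
        (∃ m : ℕ, m ≤ n ∧ Nonempty (G ≃* Multiplicative (Fin m → ZMod 2)))) := by
  have : NeZero n := ⟨by omega⟩
  constructor
  · rintro ⟨A, h, hA, ⟨F⟩⟩
    exact TVAutomaton.classification_of_mulEquiv hA F
  · rintro (⟨m, hm, ⟨F⟩⟩ | ⟨m, hm, ⟨F⟩⟩)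
    · exact DigitAction.int.exists_automaton m (by omega) (fun _ => hm) F
    · exact DigitAction.zmodTwo.exists_automaton m hm (fun ⟨_, h⟩ => by cases h) F
end

section
/- Let G be either the infinite cyclic group or a cyclic group of order 2^r for some r ≥ 1. Then there exists an invertible 2-state time-varying automaton A over the binary alphabet {0,1} such that G ≅ G(A). -/
namespace TVAutomaton

/-- The binary odometer that carries (state `1`) only through the levels marked by `active`;
state `0` is the identity. -/
def odometer (active : ℕ → Bool) : TVAutomaton (Fin 2) where
  phi _ q x := if q = 1 ∧ x = true then 1 else 0
  psi i q x := if q = 1 ∧ active i = true then !x else x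

variable (active : ℕ → Bool)

theorem odometer_invertible : (odometer active).Invertible := by
  intro i q
  by_cases hq : q = 1 ∧ active i = true
  · simpa [odometer, hq] using Bool.involutive_not.bijective
  · simp only [odometer, hq, if_false]
    exact Function.bijective_id

theorem odometer_act_zero (w : List Bool) (i : ℕ) : (odometer active).act i 0 w = w := by
  induction w generalizing i with
  | nil => rfl
  | cons x w ih => simpa [act, odometer] using ih (i + 1)

variable {active}

theorem odometer_act_one_of_inactive (w : List Bool) {i : ℕ} (hi : ∀ j, i ≤ j → active j = false) :
    (odometer active).act i 1 w = w := by
  induction w generalizing i with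
  | nil => rfl
  | cons x w ih =>
    have ih' := ih (i := i + 1) fun j hj => hi j (by omega)
    have h0 := odometer_act_zero active w (i + 1)
    cases x <;> simp_all [act, odometer]

theorem odometer_act_one_act_one {i : ℕ} (hi : active i = true) (x : Bool) (w : List Bool) :
    (odometer active).act i 1 ((odometer active).act i 1 (x :: w)) =
      x :: (odometer active).act (i + 1) 1 w := by
  have h0 := odometer_act_zero active
  unfold odometer at h0 ⊢
  cases x <;> simp [act, hi, h0]

theorem odometer_iterate_two_mul {i : ℕ} (hi : active i = true) (k : ℕ) (x : Bool)
    (w : List Bool) :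
    ((odometer active).act i 1)^[2 * k] (x :: w) =
      x :: ((odometer active).act (i + 1) 1)^[k] w := by
  induction k generalizing w with
  | zero => rfl
  | succ k ih =>
    rw [Nat.mul_succ, Function.iterate_add_apply]
    simp only [Function.iterate_succ_apply, Function.iterate_zero, id]
    rw [odometer_act_one_act_one hi, ih]

theorem odometer_iterate_two_pow {n i : ℕ} (hact : ∀ j, i ≤ j → j < i + n → active j = true)
    (hinact : ∀ j, i + n ≤ j → active j = false) (w : List Bool) :
    ((odometer active).act i 1)^[2 ^ n] w = w := by
  induction n generalizing i w with
  | zero => simpa using odometer_act_one_of_inactive w (i := i) (by simpa using hinact)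
  | succ n ih =>
    cases w with
    | nil => exact Function.iterate_fixed rfl _
    | cons x w =>
      rw [pow_succ', odometer_iterate_two_mul (hact i le_rfl (by omega)),
        ih (fun j h₁ h₂ => hact j (by omega) (by omega)) fun j hj => hinact j (by omega)]

theorem two_pow_dvd_of_odometer_iterate {n i k : ℕ}
    (hact : ∀ j, i ≤ j → j < i + n → active j = true)
    (hk : ∀ w, ((odometer active).act i 1)^[k] w = w) : 2 ^ n ∣ k := by
  induction n generalizing i k with
  | zero => simp
  | succ n ih =>
    have hi := hact i le_rfl (by omega)
    obtain ⟨m, rfl | rfl⟩ := k.even_or_odd'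
    · rw [pow_succ']
      refine mul_dvd_mul_left 2 (ih (i := i + 1) (fun j h₁ h₂ => hact j (by omega) (by omega))
        fun w => ?_)
      simpa [odometer_iterate_two_mul hi] using hk (true :: w)
    · have h := hk [true]
      rw [Function.iterate_succ_apply', odometer_iterate_two_mul hi] at h
      simp [act, odometer, hi] at h

theorem odometer_toAut_pow_eq_one_iff (k : ℕ) :
    (odometer active).toAut (odometer_invertible active) 0 1 ^ k = 1 ↔
      ∀ w, ((odometer active).act 0 1)^[k] w = w := by
  rw [Subtype.ext_iff, Equiv.ext_iff]
  rfl

theorem odometer_genGroup (active : ℕ → Bool) :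
    (odometer active).genGroup (odometer_invertible active) =
      Subgroup.zpowers ((odometer active).toAut (odometer_invertible active) 0 1) := by
  have h0 : (odometer active).toAut (odometer_invertible active) 0 0 = 1 :=
    Subtype.ext (Equiv.ext fun w => odometer_act_zero active w 0)
  have hrange : (Set.range fun q => (odometer active).toAut (odometer_invertible active) 0 q) =
      {1, (odometer active).toAut (odometer_invertible active) 0 1} := by
    ext g
    simp [Fin.exists_fin_two, h0, eq_comm]
  rw [genGroup, hrange, Subgroup.closure_insert_one, Subgroup.zpowers_eq_closure]

theorem nonempty_mulEquiv_odometer_genGroup {G : Type*} [Group G] [IsCyclic G]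
    (hcard : Nat.card G = orderOf ((odometer active).toAut (odometer_invertible active) 0 1)) :
    Nonempty (G ≃* (odometer active).genGroup (odometer_invertible active)) := by
  rw [odometer_genGroup]
  exact ⟨mulEquivOfCyclicCardEq (hcard.trans (Nat.card_zpowers _).symm)⟩

theorem orderOf_odometer_of_forall_active :
    orderOf ((odometer fun _ => true).toAut (odometer_invertible _) 0 1) = 0 := by
  have hdvd (n : ℕ) := two_pow_dvd_of_odometer_iterate (n := n) (fun _ _ _ => rfl)
    ((odometer_toAut_pow_eq_one_iff _).1
      (pow_orderOf_eq_one ((odometer fun _ => true).toAut (odometer_invertible _) 0 1)))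
  exact Nat.eq_zero_of_dvd_of_lt (hdvd _) Nat.lt_two_pow_self

theorem orderOf_odometer_of_active_lt (r : ℕ) :
    orderOf ((odometer fun i => decide (i < r)).toAut (odometer_invertible _) 0 1) = 2 ^ r := by
  apply Nat.dvd_antisymm
  · exact orderOf_dvd_of_pow_eq_one ((odometer_toAut_pow_eq_one_iff _).2
      (odometer_iterate_two_pow (by simp) (by simp)))
  · exact two_pow_dvd_of_odometer_iterate (by simp)
      ((odometer_toAut_pow_eq_one_iff _).1 (pow_orderOf_eq_one _))

end TVAutomaton

/-- If `G` is the infinite cyclic group or a cyclic group of order `2 ^ r`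
(`r ≥ 1`), then `G` is isomorphic to the group generated by some invertible 2-state
time-varying automaton over the binary alphabet. -/
theorem cyclic_group_tva (G : Type) [Group G]
    (hG : Nonempty (G ≃* Multiplicative ℤ) ∨
      ∃ r : ℕ, 1 ≤ r ∧ Nonempty (G ≃* Multiplicative (ZMod (2 ^ r)))) :
    ∃ (A : TVAutomaton (Fin 2)) (h : A.Invertible), Nonempty (G ≃* A.genGroup h) := by
  rcases hG with ⟨⟨e⟩⟩ | ⟨r, -, ⟨e⟩⟩
  · obtain ⟨f⟩ := TVAutomaton.nonempty_mulEquiv_odometer_genGroup (G := Multiplicative ℤ)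
      (by rw [TVAutomaton.orderOf_odometer_of_forall_active]; exact Nat.card_eq_zero_of_infinite)
    exact ⟨_, _, ⟨e.trans f⟩⟩
  · obtain ⟨f⟩ := TVAutomaton.nonempty_mulEquiv_odometer_genGroup
      (G := Multiplicative (ZMod (2 ^ r)))
      (by rw [TVAutomaton.orderOf_odometer_of_active_lt]; exact Nat.card_zmod _)
    exact ⟨_, _, ⟨e.trans f⟩⟩
end

section
/- Let n ≥ 2 and let G be a finitely generated abelian group of rank exactly n whose torsion part is a non-trivial 2-group. Then there exists an invertible n-state time-varying automaton A over the binary alphabet {0,1} such that G ≅ G(A). -/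
/-! ### Binary automata whose states commute

In the `i`-th transition, every state in `s i` swaps the two letters and moves to `y i` on the
letter `1` and to `z` on the letter `0`; the other states fix both letters and do not move. All
transformations of such an automaton commute, and the product of the `q`-th transformations to
the powers `v q` is described by the integer vector `v`: it adds `∑ q ∈ s i, v q` to the letter
read, modulo two, and hands the carry over to the next level. -/

namespace CarryAutomaton

variable {Q : Type*} (s : ℕ → Finset Q)

/-- The total exponent of the active states. -/
def total (i : ℕ) (v : Q → ℤ) : ℤ := ∑ q ∈ s i, v q

theorem total_add (i : ℕ) (u v : Q → ℤ) : total s i (u + v) = total s i u + total s i v := by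
  simp [total, Finset.sum_add_distrib]

/-- The number of active factors that move to `y i` when the letter `x` is read. -/
def carry (i : ℕ) (v : Q → ℤ) (x : Bool) : ℤ := (total s i v + x.toInt) / 2

/-- The image of the letter `x`. -/
def letter (i : ℕ) (v : Q → ℤ) (x : Bool) : Bool := decide ((total s i v + x.toInt) % 2 = 1)

theorem letter_toInt (i : ℕ) (v : Q → ℤ) (x : Bool) :
    (letter s i v x).toInt = (total s i v + x.toInt) % 2 := by
  unfold letter
  rcases Int.emod_two_eq_zero_or_one (total s i v + x.toInt) with h | h <;> simp [h]

theorem carry_add (i : ℕ) (u v : Q → ℤ) (x : Bool) :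
    carry s i (u + v) x = carry s i u (letter s i v x) + carry s i v x := by
  simp only [carry, letter_toInt, total_add]
  omega

theorem letter_add (i : ℕ) (u v : Q → ℤ) (x : Bool) :
    letter s i (u + v) x = letter s i u (letter s i v x) := by
  rw [letter.eq_def s i (u + v), letter.eq_def s i u, letter_toInt, total_add]
  congr 1
  simp only [eq_iff_iff]
  omega

theorem letter_zero (i : ℕ) (x : Bool) : letter s i 0 x = x := by
  cases x <;> simp [letter, total]

theorem letter_of_even {i : ℕ} {v : Q → ℤ} (h : 2 ∣ total s i v) (x : Bool) :
    letter s i v x = x := by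
  cases x <;> simp [letter] <;> grind

variable [DecidableEq Q] (y : ℕ → Q) (z : Q)

/-- The automaton in which the states of `s i` are active in the `i`-th transition. -/
def automaton : TVAutomaton Q where
  phi i q x := if q ∈ s i then (if x then y i else z) else q
  psi i q x := if q ∈ s i then !x else x

theorem automaton_invertible : (automaton s y z).Invertible := by
  intro i q
  by_cases hq : q ∈ s i
  · convert Bool.involutive_not.bijective using 2 with x
    simp [automaton, hq]
  · convert Function.bijective_id using 2 with x
    simp [automaton, hq, Function.id_def]

/-- The exponent vector of the section at the letter `x`. -/
def sect (i : ℕ) (v : Q → ℤ) (x : Bool) : Q → ℤ :=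
  (s i).piecewise (0 : Q → ℤ) v + Pi.single (y i) (carry s i v x) +
    Pi.single z (total s i v - carry s i v x)

/-- The transformation of words with exponent vector `v`. -/
def wordAct : ℕ → (Q → ℤ) → List Bool → List Bool
  | _, _, [] => []
  | i, v, x :: w => letter s i v x :: wordAct (i + 1) (sect s y z i v x) w

theorem sect_add (i : ℕ) (u v : Q → ℤ) (x : Bool) :
    sect s y z i (u + v) x = sect s y z i u (letter s i v x) + sect s y z i v x := by
  ext q
  simp only [sect, carry_add, total_add, Pi.add_apply, Finset.piecewise, Pi.single_apply,
    Pi.zero_apply]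
  split_ifs <;> ring

theorem wordAct_add (w : List Bool) (i : ℕ) (u v : Q → ℤ) :
    wordAct s y z i (u + v) w = wordAct s y z i u (wordAct s y z i v w) := by
  induction w generalizing i u v with
  | nil => rfl
  | cons x w ih => simp only [wordAct, letter_add, sect_add, ih]

theorem sect_zero (i : ℕ) (x : Bool) : sect s y z i 0 x = 0 := by
  have h : carry s i 0 x = 0 := by cases x <;> simp [carry, total]
  ext q
  simp [sect, h, total, Finset.piecewise]

theorem wordAct_zero (w : List Bool) (i : ℕ) : wordAct s y z i 0 w = w := by
  induction w generalizing i with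
  | nil => rfl
  | cons x w ih => simp only [wordAct, letter_zero, sect_zero, ih]

theorem total_single (i : ℕ) (q : Q) : total s i (Pi.single q 1) = if q ∈ s i then 1 else 0 := by
  simp [total, Pi.single_apply]

theorem letter_single (i : ℕ) (q : Q) (x : Bool) :
    letter s i (Pi.single q 1) x = (automaton s y z).psi i q x := by
  by_cases hq : q ∈ s i <;> cases x <;> simp [letter, total_single, automaton, hq]

theorem sect_single (i : ℕ) (q : Q) (x : Bool) :
    sect s y z i (Pi.single q 1) x = Pi.single ((automaton s y z).phi i q x) 1 := by
  ext p
  by_cases hq : q ∈ s i <;> cases x <;>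
    simp [sect, carry, total_single, automaton, hq, Finset.piecewise, Pi.single_apply] <;> grind

theorem wordAct_single (w : List Bool) (i : ℕ) (q : Q) :
    wordAct s y z i (Pi.single q 1) w = (automaton s y z).act i q w := by
  induction w generalizing i q with
  | nil => rfl
  | cons x w ih => rw [wordAct, TVAutomaton.act, letter_single s y z, sect_single, ih]

theorem wordAct_concat (w : List Bool) (i : ℕ) (v : Q → ℤ) (x : Bool) :
    ∃ b, wordAct s y z i v (w ++ [x]) = wordAct s y z i v w ++ [b] := by
  induction w generalizing i v with
  | nil => exact ⟨letter s i v x, rfl⟩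
  | cons a w ih =>
    obtain ⟨b, hb⟩ := ih (i + 1) (sect s y z i v a)
    exact ⟨b, by simp [wordAct, hb]⟩

/-- The transformation with exponent vector `v`, as a permutation of the set of words. -/
def wordPerm (v : Q → ℤ) : Equiv.Perm (List Bool) where
  toFun := wordAct s y z 0 v
  invFun := wordAct s y z 0 (-v)
  left_inv w := by rw [← wordAct_add, neg_add_cancel, wordAct_zero]
  right_inv w := by rw [← wordAct_add, add_neg_cancel, wordAct_zero]

/-- The homomorphism sending an exponent vector to the tree automorphism it describes. -/
def toTreeAut : Multiplicative (Q → ℤ) →* ↥binTreeAut where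
  toFun v := ⟨wordPerm s y z v.toAdd, rfl, fun w x => wordAct_concat s y z w 0 v.toAdd x⟩
  map_one' := Subtype.ext (Equiv.ext fun w => wordAct_zero s y z w 0)
  map_mul' u v := Subtype.ext (Equiv.ext fun w => wordAct_add s y z w 0 u.toAdd v.toAdd)

theorem toTreeAut_single (q : Q) :
    toTreeAut s y z (Multiplicative.ofAdd (Pi.single q 1)) =
      (automaton s y z).toAut (automaton_invertible s y z) 0 q :=
  Subtype.ext (Equiv.ext fun w => wordAct_single s y z w 0 q)

theorem closure_single_eq_top [Finite Q] :
    Subgroup.closure (Set.range fun q : Q => Multiplicative.ofAdd (Pi.single q (1 : ℤ))) = ⊤ := by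
  cases nonempty_fintype Q
  rw [eq_top_iff]
  intro v _
  have hv : v = ∏ q, Multiplicative.ofAdd (Pi.single q (1 : ℤ) : Q → ℤ) ^ (v.toAdd q) := by
    apply Multiplicative.toAdd.injective
    ext p
    simp [toAdd_prod, Finset.sum_apply, Pi.single_apply]
  rw [hv]
  exact Subgroup.prod_mem _ fun q _ =>
    Subgroup.zpow_mem _ (Subgroup.subset_closure (Set.mem_range_self q)) _

theorem range_toTreeAut [Finite Q] :
    (toTreeAut s y z).range = (automaton s y z).genGroup (automaton_invertible s y z) := by
  rw [MonoidHom.range_eq_map, ← closure_single_eq_top, MonoidHom.map_closure,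
    TVAutomaton.genGroup, ← Set.range_comp]
  congr 2
  ext1 q
  exact toTreeAut_single s y z q

/-- The exponent vector `v` describes the trivial transformation at level `i`. -/
def IsTrivial (i : ℕ) (v : Q → ℤ) : Prop := ∀ w, wordAct s y z i v w = w

theorem toTreeAut_eq_one_iff (v : Multiplicative (Q → ℤ)) :
    toTreeAut s y z v = 1 ↔ IsTrivial s y z 0 v.toAdd :=
  ⟨fun h w => congrArg (fun g : ↥binTreeAut => (g : Equiv.Perm (List Bool)) w) h,
    fun h => Subtype.ext (Equiv.ext h)⟩

theorem sect_of_even {i : ℕ} {v : Q → ℤ} (h : 2 ∣ total s i v) (x : Bool) :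
    sect s y z i v x = sect s y z i v false := by
  have hc : carry s i v x = carry s i v false := by cases x <;> simp [carry]; omega
  simp only [sect, hc]

theorem isTrivial_iff (i : ℕ) (v : Q → ℤ) :
    IsTrivial s y z i v ↔
      2 ∣ total s i v ∧ IsTrivial s y z (i + 1) (sect s y z i v false) := by
  constructor
  · intro h
    refine ⟨?_, fun w => (List.cons.inj (h (false :: w))).2⟩
    have h0 := (List.cons.inj (h [false])).1
    simp only [letter, Bool.toInt_false, add_zero, decide_eq_false_iff_not] at h0
    omega
  · rintro ⟨he, h⟩ (_ | ⟨x, w⟩)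
    · rfl
    · rw [wordAct, letter_of_even s he, sect_of_even s y z he, h w]

/-- Groups presented by the relations of the automaton are generated by it. -/
theorem nonempty_mulEquiv_genGroup [Finite Q] {G : Type*} [CommGroup G]
    (f : Multiplicative (Q → ℤ) →* G) (hf : Function.Surjective f)
    (hker : ∀ v : Q → ℤ, f (Multiplicative.ofAdd v) = 1 ↔ IsTrivial s y z 0 v) :
    Nonempty (G ≃* (automaton s y z).genGroup (automaton_invertible s y z)) := by
  have hk : f.ker = (toTreeAut s y z).ker := by
    ext v
    rw [MonoidHom.mem_ker, MonoidHom.mem_ker, toTreeAut_eq_one_iff]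
    exact hker v.toAdd
  rw [← range_toTreeAut]
  exact ⟨(QuotientGroup.quotientKerEquivOfSurjective f hf).symm.trans
    ((QuotientGroup.quotientMulEquivOfEq hk).trans
      (QuotientGroup.quotientKerEquivRange (toTreeAut s y z)))⟩

end CarryAutomaton

/-! ### An automaton with prescribed relations -/

namespace CarryAutomaton

theorem dvd_two_pow_of_not_dvd {m r : ℕ} (hm : m = 0 ∨ ∃ e, m = 2 ^ e) (h : ¬ 2 ^ (r + 1) ∣ m) :
    m ∣ 2 ^ r := by
  rcases hm with rfl | ⟨e, rfl⟩
  · simp at h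
  · rw [Nat.pow_dvd_pow_iff_le_right (by norm_num)] at h
    exact pow_dvd_pow 2 (by omega)

variable {Q : Type*} {s : ℕ → Finset Q}

theorem total_of_empty {i : ℕ} (hs : s i = ∅) (v : Q → ℤ) : total s i v = 0 := by
  simp [total, hs]

theorem total_of_singleton {i : ℕ} {j : Q} (hs : s i = {j}) (v : Q → ℤ) :
    total s i v = v j := by
  simp [total, hs]

variable [DecidableEq Q] {y : ℕ → Q} {z : Q}

theorem sect_of_empty {i : ℕ} (hs : s i = ∅) (v : Q → ℤ) : sect s y z i v false = v := by
  ext q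
  simp [sect, carry, total, hs]

theorem sect_of_singleton {i : ℕ} {j : Q} (hs : s i = {j}) (hy : y i = j) (v : Q → ℤ) {q : Q}
    (hq : q ≠ z) : sect s y z i v false q = if q = j then v q / 2 else v q := by
  by_cases h : q = j
  · subst h
    simp [sect, carry, total, hs, hy, hq]
  · simp [sect, hs, hy, hq, h]

theorem sect_base_of_singleton {i : ℕ} {j : Q} (hs : s i = {j}) (hy : y i = j) (hj : j ≠ z)
    (v : Q → ℤ) : sect s y z i v false z = v z + (v j - v j / 2) := by
  simp [sect, carry, total, hs, hy, hj.symm]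

theorem total_of_pair {i : ℕ} {a : Q} (ha : a ≠ z) (hs : s i = {z, a}) (v : Q → ℤ) :
    total s i v = v z + v a := by
  rw [total, hs, Finset.sum_pair ha.symm]

theorem sect_of_pair {i : ℕ} {a : Q} (ha : a ≠ z) (hs : s i = {z, a}) (hy : y i = a)
    (v : Q → ℤ) {q : Q} (hq : q ≠ z) :
    sect s y z i v false q = if q = a then (v z + v a) / 2 else v q := by
  by_cases h : q = a
  · subst h
    simp [sect, carry, total_of_pair ha hs, hs, hy, hq]
  · simp [sect, hs, hy, hq, h]

/-- The state `c t` is to be halved at time `t`, given that the coordinate `q` has to be halved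
as often as `o q` is divisible by two. -/
def Active (c : ℕ → Q) (z : Q) (o : Q → ℕ) (t : ℕ) : Prop :=
  c t ≠ z ∧ 2 ^ (Nat.count (fun u => c u = c t) t + 1) ∣ o (c t)

section Tail

variable {c : ℕ → Q} {o : Q → ℕ} {b : ℕ}
  (hs : ∀ t, Active c z o t → s (b + t) = {c t})
  (hs' : ∀ t, ¬ Active c z o t → s (b + t) = ∅) (hy : ∀ t, y (b + t) = c t)

include hs hs' hy

theorem tail_step {t : ℕ} {v : Q → ℤ}
    (h : ∀ q, q ≠ z → (o q : ℤ) ∣ 2 ^ Nat.count (fun u => c u = q) t * v q) :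
    2 ∣ total s (b + t) v ∧ ∀ q, q ≠ z →
      (o q : ℤ) ∣ 2 ^ Nat.count (fun u => c u = q) (t + 1) * sect s y z (b + t) v false q := by
  by_cases hA : Active c z o t
  · have h2 : (2 : ℤ) ∣ v (c t) := by
      have h1 : (2 ^ (Nat.count (fun u => c u = c t) t + 1) : ℤ) ∣
          2 ^ Nat.count (fun u => c u = c t) t * v (c t) :=
        dvd_trans (by exact_mod_cast hA.2) (h _ hA.1)
      rw [pow_succ] at h1
      exact Int.dvd_of_mul_dvd_mul_left (by positivity) h1
    refine ⟨by rwa [total_of_singleton (hs t hA)], fun q hq => ?_⟩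
    rw [sect_of_singleton (hs t hA) (hy t) v hq, Nat.count_succ]
    split_ifs with h1 h3 h3
    · subst h1
      rw [pow_succ, mul_assoc, Int.mul_ediv_cancel' h2]
      exact h _ hq
    · exact absurd h1.symm h3
    · exact absurd h3.symm h1
    · simpa using h q hq
  · rw [total_of_empty (hs' t hA), sect_of_empty (hs' t hA)]
    refine ⟨dvd_zero 2, fun q hq => (h q hq).trans ?_⟩
    gcongr
    simp

theorem isTrivial_of_dvd {t : ℕ} {v : Q → ℤ}
    (h : ∀ q, q ≠ z → (o q : ℤ) ∣ 2 ^ Nat.count (fun u => c u = q) t * v q) :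
    IsTrivial s y z (b + t) v := by
  intro w
  induction w generalizing t v with
  | nil => rfl
  | cons x w ih =>
    obtain ⟨h2, h'⟩ := tail_step hs hs' hy h
    rw [wordAct, letter_of_even s h2, sect_of_even s y z h2, add_assoc, ih h']

variable (ho : ∀ q, o q = 0 ∨ ∃ e, o q = 2 ^ e)

include ho

theorem dvd_of_isTrivial {t : ℕ} {v : Q → ℤ} (h : IsTrivial s y z (b + t) v) {q : Q}
    (hq : q ≠ z) {d : ℕ} (hd : d ∣ o q) {N : ℕ}
    (hN : d ∣ 2 ^ Nat.count (fun u => c u = q) (t + N)) :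
    (d : ℤ) ∣ 2 ^ Nat.count (fun u => c u = q) t * v q := by
  induction N generalizing t v with
  | zero => exact Dvd.dvd.mul_right (by exact_mod_cast hN) _
  | succ N ih =>
    obtain ⟨h2, h'⟩ := (isTrivial_iff s y z _ _).1 h
    have := ih (t := t + 1) h' (by rwa [add_assoc, add_comm 1])
    by_cases hA : Active c z o t
    · rw [total_of_singleton (hs t hA)] at h2
      rw [sect_of_singleton (hs t hA) (hy t) v hq, Nat.count_succ] at this
      split_ifs at this with h1 h3 h3
      · subst h1
        rwa [pow_succ, mul_assoc, Int.mul_ediv_cancel' h2] at this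
      · exact absurd h1.symm h3
      · exact absurd h3.symm h1
      · simpa using this
    · rw [sect_of_empty (hs' t hA), Nat.count_succ] at this
      by_cases hc : c t = q
      · subst hc
        refine Dvd.dvd.mul_right ((Int.natCast_dvd_natCast.2 hd).trans ?_) _
        exact_mod_cast dvd_two_pow_of_not_dvd (ho _) fun h => hA ⟨hq, h⟩
      · simpa [hc] using this

theorem isTrivial_tail_iff (hc : ∀ q, {t | c t = q}.Infinite) (v : Q → ℤ) :
    IsTrivial s y z b v ↔ ∀ q, q ≠ z → (o q : ℤ) ∣ v q := by
  constructor
  · intro h q hq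
    have key : ∀ e, 2 ^ e ∣ o q → ((2 ^ e : ℕ) : ℤ) ∣ v q := fun e he => by
      obtain ⟨N, hN⟩ := Nat.surjective_count_of_infinite_setOfPred (hc q) e
      have := dvd_of_isTrivial hs hs' hy ho (t := 0) h hq he (N := N) (by rw [zero_add, hN])
      simpa using this
    rcases ho q with h0 | ⟨e, he⟩
    · rw [h0]
      rw [h0] at key
      by_contra hv
      rw [Nat.cast_zero, zero_dvd_iff] at hv
      have := Int.natAbs_dvd_natAbs.2 (key (v q).natAbs (dvd_zero _))
      rw [Int.natAbs_natCast] at this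
      exact absurd (Nat.le_of_dvd (by omega) this) (not_le.2 Nat.lt_two_pow_self)
    · rw [he]
      exact key e he.symm.dvd
  · intro h
    exact isTrivial_of_dvd hs hs' hy (t := 0) fun q hq => by simpa using h q hq

end Tail

section Construction

variable (c : ℕ → Q) (a z : Q) (k : ℕ) (o : Q → ℕ)

open Classical in
/-- The active states of the automaton: `a` in the first `k` transitions, `z` and `a` in the
next one, and from then on those that realize the orders `o`, halving the order of `a`. -/
noncomputable def activeStates (i : ℕ) : Finset Q :=
  if i < k then {a} else if i = k then {z, a} else
    if Active c z (Function.update o a (o a / 2)) (i - (k + 1)) then {c (i - (k + 1))} else ∅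

/-- The states to which the carry is handed over. -/
def carryStates (i : ℕ) : Q := if i ≤ k then a else c (i - (k + 1))

variable {c a z k o}

theorem isTrivial_at_collapse_iff (ha : a ≠ z) (hc : ∀ q, {t | c t = q}.Infinite)
    (ho : ∀ q, o q = 0 ∨ ∃ e, o q = 2 ^ (e + 1)) (v : Q → ℤ) :
    IsTrivial (activeStates c a z k o) (carryStates c a k) z k v ↔
      (o a : ℤ) ∣ v z + v a ∧ ∀ q, q ≠ z → q ≠ a → (o q : ℤ) ∣ v q := by
  have hs : activeStates c a z k o k = {z, a} := by simp [activeStates]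
  have hy : carryStates c a k k = a := by simp [carryStates]
  have ho' : ∀ q, Function.update o a (o a / 2) q = 0 ∨
      ∃ e, Function.update o a (o a / 2) q = 2 ^ e := by
    intro q
    by_cases hq : q = a
    · subst hq
      rcases ho q with h | ⟨e, h⟩
      · simp [h]
      · exact Or.inr ⟨e, by simp [h, pow_succ]⟩
    · rcases ho q with h | ⟨e, h⟩
      · simp [hq, h]
      · exact Or.inr ⟨e + 1, by simp [hq, h]⟩
  have hoa : ∃ d, o a = 2 * d := by
    rcases ho a with h | ⟨e, h⟩
    · exact ⟨0, h⟩
    · exact ⟨2 ^ e, by rw [h, pow_succ']⟩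
  rw [isTrivial_iff, total_of_pair ha hs, isTrivial_tail_iff (c := c) _ _ _ ho' hc]
  · have hpair : ∀ q, q ≠ z → sect (activeStates c a z k o) (carryStates c a k) z k v false q =
        if q = a then (v z + v a) / 2 else v q := fun q hq => sect_of_pair ha hs hy v hq
    obtain ⟨d, hd⟩ := hoa
    have hdiv : o a / 2 = d := by omega
    have hhalf : 2 ∣ v z + v a ∧ (d : ℤ) ∣ (v z + v a) / 2 ↔ ((2 * d : ℕ) : ℤ) ∣ v z + v a := by
      constructor
      · rintro ⟨⟨x, hx⟩, h⟩
        rw [hx] at h ⊢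
        rw [Int.mul_ediv_cancel_left _ (by norm_num)] at h
        push_cast
        exact mul_dvd_mul_left 2 h
      · rintro ⟨x, hx⟩
        push_cast at hx
        rw [hx, mul_assoc]
        exact ⟨dvd_mul_right _ _, by
          rw [Int.mul_ediv_cancel_left _ (by norm_num)]; exact dvd_mul_right _ _⟩
    rw [hd, ← hhalf, and_assoc]
    refine and_congr_right fun _ => ⟨fun h => ⟨?_, fun q hq hqa => ?_⟩, fun h q hq => ?_⟩
    · simpa [hpair a ha, hdiv] using h a ha
    · simpa [hpair q hq, hqa] using h q hq
    · by_cases hqa : q = a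
      · subst hqa
        simpa [hpair q ha, hdiv] using h.1
      · simpa [hpair q hq, hqa] using h.2 q hq hqa
  · intro t hA
    have h1 : ¬ k + 1 + t < k := by omega
    have h2 : k + 1 + t ≠ k := by omega
    simp [activeStates, h1, h2, hA]
  · intro t hA
    have h1 : ¬ k + 1 + t < k := by omega
    have h2 : k + 1 + t ≠ k := by omega
    simp [activeStates, h1, h2, hA]
  · intro t
    have h1 : ¬ k + 1 + t ≤ k := by omega
    simp [carryStates, h1]

theorem isTrivial_construction_iff (ha : a ≠ z) (hc : ∀ q, {t | c t = q}.Infinite)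
    (ho : ∀ q, o q = 0 ∨ ∃ e, o q = 2 ^ (e + 1)) {i j : ℕ} (hij : i + j = k) (v : Q → ℤ) :
    IsTrivial (activeStates c a z k o) (carryStates c a k) z i v ↔
      2 ^ j ∣ v a ∧ (o a : ℤ) ∣ v z + v a ∧ ∀ q, q ≠ z → q ≠ a → (o q : ℤ) ∣ v q := by
  induction j generalizing i v with
  | zero =>
    obtain rfl : i = k := by omega
    rw [isTrivial_at_collapse_iff ha hc ho]
    simp
  | succ j ih =>
    have hs : activeStates c a z k o i = {a} := by simp [activeStates]; omega
    have hy : carryStates c a k i = a := by simp [carryStates]; omega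
    rw [isTrivial_iff, ih (by omega), total_of_singleton hs, sect_base_of_singleton hs hy ha,
      sect_of_singleton hs hy v ha, if_pos rfl, add_assoc, sub_add_cancel, ← and_assoc]
    refine and_congr ⟨?_, fun h => ?_⟩ (and_congr_right fun _ => forall₃_congr fun q hq hqa => by
      rw [sect_of_singleton hs hy v hq, if_neg hqa])
    · rintro ⟨h2, h⟩
      rw [← Int.mul_ediv_cancel' h2, pow_succ']
      exact mul_dvd_mul_left 2 h
    · rw [pow_succ'] at h
      exact ⟨dvd_of_mul_right_dvd h, Int.dvd_ediv_of_mul_dvd h⟩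

end Construction

end CarryAutomaton

/-! ### Presentations of finitely generated abelian groups -/

/-- The homomorphism `g` presents `G` as the direct product of the groups `ℤ / (o q)`. -/
def IsCyclicPresentation {κ G : Type*} [CommGroup G] (o : κ → ℕ)
    (g : Multiplicative (κ → ℤ) →* G) : Prop :=
  Function.Surjective g ∧ ∀ v : κ → ℤ, g (Multiplicative.ofAdd v) = 1 ↔ ∀ q, (o q : ℤ) ∣ v q

namespace IsCyclicPresentation

variable {κ G : Type*} [CommGroup G] {o : κ → ℕ} {g : Multiplicative (κ → ℤ) →* G}

theorem reindex {Q : Type*} (ε : Q ≃ κ) (hg : IsCyclicPresentation o g) :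
    IsCyclicPresentation (o ∘ ε) (g.comp (AddMonoidHom.toMultiplicative
      (LinearMap.funLeft ℤ ℤ ε.symm).toAddMonoidHom)) := by
  refine ⟨hg.1.comp fun v => ⟨Multiplicative.ofAdd (v.toAdd ∘ ε), ?_⟩, fun v => ?_⟩
  · apply Multiplicative.toAdd.injective
    ext q
    simp [LinearMap.funLeft]
  · refine (hg.2 (v ∘ ε.symm)).trans ⟨fun h q => ?_, fun h q => ?_⟩
    · simpa using h (ε q)
    · simpa using h (ε.symm q)

theorem rank_eq [Group.FG G] [Fintype κ] (hg : IsCyclicPresentation o g) (ho : ∀ q, 2 ∣ o q) :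
    Group.rank G = Fintype.card κ := by
  classical
  apply le_antisymm
  · have hcl : Subgroup.closure ((Finset.univ.image fun q : κ =>
        g (Multiplicative.ofAdd (Pi.single q (1 : ℤ))) : Finset G) : Set G) = ⊤ := by
      rw [Finset.coe_image, Finset.coe_univ, Set.image_univ, Set.range_comp' g,
        ← MonoidHom.map_closure, CarryAutomaton.closure_single_eq_top,
        Subgroup.map_top_of_surjective g hg.1]
    exact (Group.rank_le hcl).trans (Finset.card_image_le.trans_eq Finset.card_univ)
  · let r : Multiplicative (κ → ℤ) →* Multiplicative (κ → ZMod 2) := AddMonoidHom.toMultiplicative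
      ((Int.castAddHom (ZMod 2)).compLeft κ)
    have hr : Function.Surjective r := fun u =>
      ⟨Multiplicative.ofAdd fun q => ((u.toAdd q).val : ℤ), by
        apply Multiplicative.toAdd.injective
        ext q
        simp [r]⟩
    have hker : g.ker ≤ r.ker := by
      intro v hv
      rw [MonoidHom.mem_ker] at hv ⊢
      apply Multiplicative.toAdd.injective
      ext q
      have h2 : ((2 : ℕ) : ℤ) ∣ v.toAdd q :=
        (Int.natCast_dvd_natCast.2 (ho q)).trans ((hg.2 v.toAdd).1 hv q)
      simpa [r] using (ZMod.intCast_zmod_eq_zero_iff_dvd _ 2).2 h2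
    let f : G →* Multiplicative (κ → ZMod 2) := g.liftOfSurjective hg.1 ⟨r, hker⟩
    have hf : ∀ v, f (g v) = r v := fun v => MonoidHom.liftOfRightInverse_comp_apply g _ _ _ v
    have hfs : Function.Surjective f := fun u => by
      obtain ⟨v, rfl⟩ := hr u
      exact ⟨g v, hf v⟩
    obtain ⟨S, hS, hcl⟩ := Group.rank_spec G
    let b : S → κ → ZMod 2 := fun x => (f x).toAdd
    have hmem : ∀ x : G, (f x).toAdd ∈ Submodule.span (ZMod 2) (Set.range b) := by
      intro x
      have hxS : x ∈ Subgroup.closure (S : Set G) := hcl ▸ Subgroup.mem_top x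
      induction hxS using Subgroup.closure_induction with
      | mem x hx => exact Submodule.subset_span ⟨⟨x, hx⟩, rfl⟩
      | one => simp
      | mul x y _ _ hx hy => simpa using add_mem hx hy
      | inv x _ hx => simpa using hx
    have hspan : Submodule.span (ZMod 2) (Set.range b) = ⊤ := by
      rw [eq_top_iff]
      intro u _
      obtain ⟨x, hx⟩ := hfs (Multiplicative.ofAdd u)
      simpa [hx] using hmem x
    have hle := finrank_le_of_span_eq_top hspan
    rwa [Module.finrank_fintype_fun_eq_card, Fintype.card_coe, hS] at hle

theorem exists_ne_zero (hg : IsCyclicPresentation o g) (ht : ∃ x : G, x ≠ 1 ∧ IsOfFinOrder x) :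
    ∃ q, o q ≠ 0 := by
  by_contra! h0
  obtain ⟨x, hx, hfin⟩ := ht
  obtain ⟨v, rfl⟩ := hg.1 x
  obtain ⟨m, hm, hpow⟩ := isOfFinOrder_iff_pow_eq_one.1 hfin
  rw [← map_pow] at hpow
  refine hx ((hg.2 v.toAdd).2 fun q => ?_)
  have := (hg.2 (m • v.toAdd)).1 hpow q
  rw [h0 q, Nat.cast_zero, zero_dvd_iff] at this ⊢
  simpa [hm.ne'] using this

theorem eq_two_of_prime_pow [DecidableEq κ] (hg : IsCyclicPresentation o g)
    (h2 : ∀ x : G, IsOfFinOrder x → ∃ k : ℕ, orderOf x = 2 ^ k) {q : κ} {p e : ℕ}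
    (hp : p.Prime) (he : e ≠ 0) (hq : o q = p ^ e) : p = 2 := by
  set x := g (Multiplicative.ofAdd (Pi.single q 1))
  have hx1 : x ≠ 1 := by
    intro h
    have := (hg.2 _).1 h q
    rw [Pi.single_eq_same, hq] at this
    have h1 : p ^ e ∣ 1 := by exact_mod_cast this
    exact hp.one_lt.ne' (Nat.dvd_one.1 ((dvd_pow_self p he).trans h1))
  have hpow : x ^ p ^ e = 1 := by
    rw [← map_pow, ← ofAdd_nsmul, hg.2]
    intro q'
    by_cases h : q' = q
    · subst h
      simp [hq]
    · simp [h]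
  obtain ⟨k, hk⟩ := h2 x (isOfFinOrder_iff_pow_eq_one.2 ⟨p ^ e, pow_pos hp.pos e, hpow⟩)
  have hk0 : k ≠ 0 := by
    rintro rfl
    exact hx1 (orderOf_eq_one_iff.1 (by simpa using hk))
  have hdvd : 2 ∣ p ^ e := (dvd_pow_self 2 hk0).trans (hk ▸ orderOf_dvd_of_pow_eq_one hpow)
  exact ((Nat.prime_dvd_prime_iff_eq Nat.prime_two hp).1 (Nat.prime_two.dvd_of_dvd_pow hdvd)).symm

end IsCyclicPresentation

theorem exists_isCyclicPresentation (G : Type*) [CommGroup G] [Group.FG G] :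
    ∃ (κ : Type) (_ : Fintype κ) (o : κ → ℕ) (g : Multiplicative (κ → ℤ) →* G),
      IsCyclicPresentation o g ∧
        ∀ q, o q = 0 ∨ ∃ p e : ℕ, p.Prime ∧ e ≠ 0 ∧ o q = p ^ e := by
  classical
  obtain ⟨ι, j, _, _, p, hp, e, ⟨f⟩⟩ := CommGroup.equiv_free_prod_prod_multiplicative_zmod G
  let g : Multiplicative (j ⊕ {i // e i ≠ 0} → ℤ) →*
      (j → Multiplicative ℤ) × ((i : ι) → Multiplicative (ZMod (p i ^ e i))) :=
    { toFun := fun v => (fun a => Multiplicative.ofAdd (v.toAdd (Sum.inl a)),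
        fun i => Multiplicative.ofAdd
          (if h : e i ≠ 0 then ((v.toAdd (Sum.inr ⟨i, h⟩) : ℤ) : ZMod (p i ^ e i)) else 0))
      map_one' := by
        ext i
        · simp
        · apply Multiplicative.toAdd.injective
          simp
      map_mul' := fun u v => by
        ext i
        · simp
        · apply Multiplicative.toAdd.injective
          by_cases h : e i = 0 <;> simp [h] }
  refine ⟨j ⊕ {i // e i ≠ 0}, inferInstance, Sum.elim (fun _ => 0) fun i => p i ^ e i,
    f.symm.toMonoidHom.comp g, ⟨f.symm.surjective.comp fun u => ?_, fun v => ?_⟩, ?_⟩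
  · refine ⟨Multiplicative.ofAdd (Sum.elim (fun a => (u.1 a).toAdd)
      fun i => ((u.2 i).toAdd.cast : ℤ)), Prod.ext (funext fun a => ?_) (funext fun i => ?_)⟩
    · simp [g]
    · apply Multiplicative.toAdd.injective
      by_cases h : e i = 0
      · have : Subsingleton (ZMod (p i ^ e i)) := by rw [h, pow_zero]; infer_instance
        exact Subsingleton.elim (α := ZMod (p i ^ e i)) _ _
      · simp [g, h]
  · rw [MonoidHom.comp_apply]
    refine (map_eq_one_iff f.symm f.symm.injective).trans ?_
    rw [Prod.ext_iff, funext_iff, funext_iff, Sum.forall]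
    refine and_congr (forall_congr' fun a => ?_) ⟨fun h i => ?_, fun h i => ?_⟩
    · simp [g]
    · have := congrArg Multiplicative.toAdd (h i)
      simpa [g, i.2, ZMod.intCast_zmod_eq_zero_iff_dvd] using this
    · apply Multiplicative.toAdd.injective
      by_cases hi : e i = 0
      · simp [g, hi]
      · simpa [g, hi, ZMod.intCast_zmod_eq_zero_iff_dvd] using h ⟨i, hi⟩
  · rintro (a | i)
    · exact Or.inl rfl
    · exact Or.inr ⟨p i, e i, hp i, i.2, rfl⟩

theorem infinite_setOf_ofNat_eq {n : ℕ} [NeZero n] (q : Fin n) :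
    {t | Fin.ofNat n t = q}.Infinite := by
  refine Set.infinite_of_injective_forall_mem (f := fun t : ℕ => t * n + q) (fun t u h => ?_)
    fun t => ?_
  · simpa [NeZero.ne n] using h
  · ext
    simp [Fin.ofNat, Nat.mod_eq_of_lt q.2]

theorem exists_automaton_of_isCyclicPresentation {n : ℕ} [NeZero n] {G : Type*} [CommGroup G]
    {o : Fin n → ℕ} {g : Multiplicative (Fin n → ℤ) →* G} (hg : IsCyclicPresentation o g)
    (ho : ∀ q, o q = 0 ∨ ∃ e, o q = 2 ^ (e + 1)) {a z : Fin n} (ha : a ≠ z) (hz : o z ≠ 0) :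
    ∃ (A : TVAutomaton (Fin n)) (h : A.Invertible), Nonempty (G ≃* A.genGroup h) := by
  obtain ⟨e, he⟩ := (ho z).resolve_left hz
  let m : (Fin n → ℤ) →+ (Fin n → ℤ) :=
    { toFun := fun v q => if q = z then v a else if q = a then v z + v a else v q
      map_zero' := by ext q; simp
      map_add' := fun u v => by
        ext q
        simp only [Pi.add_apply]
        split_ifs <;> ring }
  have hm : Function.Surjective m := by
    intro u
    refine ⟨fun q => if q = a then u z else if q = z then u a - u z else u q, ?_⟩
    ext q
    by_cases hqz : q = z
    · simp [m, hqz]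
    · by_cases hqa : q = a
      · subst hqa
        simp [m, hqz, ha.symm]
      · simp [m, hqz, hqa]
  refine ⟨_, _, CarryAutomaton.nonempty_mulEquiv_genGroup
    (CarryAutomaton.activeStates (Fin.ofNat n) a z (e + 1) o)
    (CarryAutomaton.carryStates (Fin.ofNat n) a (e + 1)) z
    (g.comp (AddMonoidHom.toMultiplicative m)) (hg.1.comp hm) fun v => ?_⟩
  rw [CarryAutomaton.isTrivial_construction_iff ha infinite_setOf_ofNat_eq ho (zero_add _)]
  refine (hg.2 (m v)).trans ⟨fun h => ⟨?_, ?_, fun q hqz hqa => ?_⟩, fun h q => ?_⟩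
  · simpa [m, he] using h z
  · simpa [m, ha] using h a
  · simpa [m, hqz, hqa] using h q
  · by_cases hqz : q = z
    · subst hqz
      simpa [m, he] using h.1
    · by_cases hqa : q = a
      · subst hqa
        simpa [m, hqz] using h.2.1
      · simpa [m, hqz, hqa] using h.2.2 q hqz hqa

/-- For `n ≥ 2`, every finitely generated abelian group of rank exactly `n`
whose torsion part is a non-trivial 2-group is isomorphic to the group generated by some
invertible `n`-state time-varying automaton over the binary alphabet. -/
theorem tva_rank_n_with_torsion (n : ℕ) (hn : 2 ≤ n) (G : Type) [CommGroup G] [Group.FG G]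
    (hrank : Group.rank G = n)
    (htors : ∃ g : G, g ≠ 1 ∧ IsOfFinOrder g)
    (h2 : ∀ g : G, IsOfFinOrder g → ∃ k : ℕ, orderOf g = 2 ^ k) :
    ∃ (A : TVAutomaton (Fin n)) (h : A.Invertible), Nonempty (G ≃* A.genGroup h) := by
  classical
  obtain ⟨κ, _, o, g, hg, ho⟩ := exists_isCyclicPresentation G
  have ho' : ∀ q, o q = 0 ∨ ∃ e, o q = 2 ^ (e + 1) := fun q =>
    (ho q).imp_right fun ⟨p, e, hp, he, hq⟩ => by
      obtain ⟨e, rfl⟩ := Nat.exists_eq_succ_of_ne_zero he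
      exact ⟨e, by rw [hq, hg.eq_two_of_prime_pow h2 hp he hq]⟩
  have heven : ∀ q, 2 ∣ o q := fun q => by
    rcases ho' q with h | ⟨e, h⟩
    · simp [h]
    · exact h ▸ dvd_pow_self 2 e.succ_ne_zero
  obtain ⟨q, hq⟩ := hg.exists_ne_zero htors
  let ε : Fin n ≃ κ := (Fintype.equivFinOfCardEq ((hg.rank_eq heven).symm.trans hrank)).symm
  have : NeZero n := ⟨by omega⟩
  have : Nontrivial (Fin n) := Fin.nontrivial_iff_two_le.2 hn
  obtain ⟨a, ha⟩ := exists_ne (ε.symm q)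
  exact exists_automaton_of_isCyclicPresentation (hg.reindex ε) (fun q => ho' (ε q)) ha
    (by simpa using hq)
end

section
/- For every n ≥ 2 there exists an invertible n-state time-varying automaton A over the binary alphabet {0,1} such that G(A) is isomorphic to the free abelian group ℤ^n of rank n. -/
namespace TVAutomaton

variable {Q : Type*} [DecidableEq Q]

/-- The vector of sections, at the letter `x`, of the element of `ℤ^Q` with coordinates `v`, when
the generator `a` acts as an odometer with sections `a` at `0` and `b` at `1`, and every other
generator fixes the first letter and has itself as both sections. -/
def latticeSection (a b : Q) (v : Q → ℤ) (x : Bool) : Q → ℤ := fun i =>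
  if i = a then (v a + if x then 0 else 1) / 2
  else if i = b then v b + (v a + if x then 1 else 0) / 2
  else v i

/-- The action of `ℤ^Q` on binary words in which, at level `t`, the generator `α t` is the only
one that changes the letter, with sections `α t` and `β (α t)`. -/
def latticeAct (α : ℕ → Q) (β : Q → Q) : ℕ → (Q → ℤ) → List Bool → List Bool
  | _, _, [] => []
  | t, v, x :: w =>
    xor x (decide (v (α t) % 2 = 1)) ::
      latticeAct α β (t + 1) (latticeSection (α t) (β (α t)) v x) w

/-- The automaton whose states act as the standard generators under `latticeAct`. -/
def latticeAutomaton (α : ℕ → Q) (β : Q → Q) : TVAutomaton Q where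
  phi t q x := if q = α t ∧ x = true then β (α t) else q
  psi t q x := xor x (decide (q = α t))

theorem latticeAutomaton_invertible (α : ℕ → Q) (β : Q → Q) :
    (latticeAutomaton α β).Invertible := by
  intro t q
  apply Function.Involutive.bijective
  intro x
  simp [latticeAutomaton]

theorem latticeSection_single {a b : Q} (hab : b ≠ a) (q : Q) (x : Bool) :
    latticeSection a b (Pi.single q 1) x =
      Pi.single (if q = a ∧ x = true then b else q) 1 := by
  funext i
  simp only [latticeSection, Pi.single_apply]
  cases x <;> grind

theorem latticeSection_zero (a b : Q) (x : Bool) : latticeSection a b 0 x = 0 := by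
  funext i
  cases x <;> simp [latticeSection]

theorem latticeSection_add (a b : Q) (u v : Q → ℤ) (x : Bool) :
    latticeSection a b (u + v) x =
      latticeSection a b u (xor x (decide (v a % 2 = 1))) + latticeSection a b v x := by
  funext i
  simp only [latticeSection, Pi.add_apply]
  by_cases h : v a % 2 = 1 <;> cases x <;> simp only [h] <;> split_ifs <;> simp_all <;> omega

theorem latticeAct_single (α : ℕ → Q) {β : Q → Q} (hβ : ∀ q, β q ≠ q) (w : List Bool) :
    ∀ (t : ℕ) (q : Q), latticeAct α β t (Pi.single q 1) w = (latticeAutomaton α β).act t q w := by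
  induction w with
  | nil => intro t q; rfl
  | cons x w ih =>
    intro t q
    rw [latticeAct, act, latticeSection_single (hβ _), ih]
    congr 1
    by_cases h : q = α t
    · simp [latticeAutomaton, h]
    · simp [latticeAutomaton, h, Ne.symm h]

theorem latticeAct_zero (α : ℕ → Q) (β : Q → Q) (w : List Bool) :
    ∀ t : ℕ, latticeAct α β t 0 w = w := by
  induction w with
  | nil => intro t; rfl
  | cons x w ih => intro t; simp [latticeAct, latticeSection_zero, ih]

theorem latticeAct_add (α : ℕ → Q) (β : Q → Q) (w : List Bool) :
    ∀ (t : ℕ) (u v : Q → ℤ),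
      latticeAct α β t (u + v) w = latticeAct α β t u (latticeAct α β t v w) := by
  induction w with
  | nil => intro t u v; rfl
  | cons x w ih =>
    intro t u v
    simp only [latticeAct]
    rw [latticeSection_add, ih]
    congr 1
    simp only [Pi.add_apply]
    rcases Int.emod_two_eq_zero_or_one (u (α t)) with h | h <;>
      rcases Int.emod_two_eq_zero_or_one (v (α t)) with h' | h' <;>
      simp [h, h', Int.add_emod]

theorem latticeAct_concat (α : ℕ → Q) (β : Q → Q) (w : List Bool) (x : Bool) :
    ∀ (t : ℕ) (v : Q → ℤ),
      ∃ y, latticeAct α β t v (w ++ [x]) = latticeAct α β t v w ++ [y] := by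
  induction w with
  | nil => intro t v; exact ⟨_, rfl⟩
  | cons a w ih =>
    intro t v
    obtain ⟨y, hy⟩ := ih (t + 1) (latticeSection (α t) (β (α t)) v a)
    exact ⟨y, by simp [latticeAct, hy]⟩

/-- The homomorphism from `ℤ^Q` to tree automorphisms given by `latticeAct` at the root. -/
def latticeHom (α : ℕ → Q) (β : Q → Q) : Multiplicative (Q → ℤ) →* ↥binTreeAut where
  toFun v :=
    ⟨{ toFun := latticeAct α β 0 v.toAdd
       invFun := latticeAct α β 0 (-v.toAdd)
       left_inv := fun w => by rw [← latticeAct_add, neg_add_cancel, latticeAct_zero]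
       right_inv := fun w => by rw [← latticeAct_add, add_neg_cancel, latticeAct_zero] },
      rfl, fun w x => latticeAct_concat α β w x 0 _⟩
  map_one' := Subtype.ext <| Equiv.ext fun w => latticeAct_zero α β w 0
  map_mul' u v := Subtype.ext <| Equiv.ext fun w => latticeAct_add α β w 0 u.toAdd v.toAdd

theorem closure_range_ofAdd_single [Fintype Q] :
    Subgroup.closure (Set.range fun q : Q => Multiplicative.ofAdd (Pi.single q (1 : ℤ))) = ⊤ := by
  refine (Subgroup.eq_top_iff' _).2 fun v => ?_
  have hv : v = ∏ q, Multiplicative.ofAdd (Pi.single q (1 : ℤ)) ^ (v.toAdd q) := by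
    apply Multiplicative.toAdd.injective
    rw [toAdd_prod]
    funext i
    simp [Finset.sum_apply, Pi.single_apply]
  rw [hv]
  exact Subgroup.prod_mem _ fun q _ =>
    Subgroup.zpow_mem _ (Subgroup.subset_closure (Set.mem_range_self q)) _

theorem genGroup_latticeAutomaton [Fintype Q] (α : ℕ → Q) {β : Q → Q} (hβ : ∀ q, β q ≠ q) :
    (latticeAutomaton α β).genGroup (latticeAutomaton_invertible α β) =
      (latticeHom α β).range := by
  rw [MonoidHom.range_eq_map, ← closure_range_ofAdd_single, MonoidHom.map_closure, genGroup,
    ← Set.range_comp]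
  congr 2
  funext q
  exact Subtype.ext <| Equiv.ext fun w => (latticeAct_single α hβ w 0 q).symm

/-- If the active coordinate `α t` is even at every time `t` along the trajectory `w` of halving
steps, and `α` cycles through all coordinates with phases of geometrically growing length, then
the trajectory is zero. -/
theorem eq_zero_of_halving_trajectory {n : ℕ} (α : ℕ → Fin n) (β : Fin n → Fin n)
    (hα : ∀ t, (α t : ℕ) = Nat.log 4 t % n) (w : ℕ → Fin n → ℤ)
    (hhalf : ∀ t, w t (α t) = 2 * w (t + 1) (α t))
    (hshift : ∀ t, w (t + 1) (β (α t)) = w t (β (α t)) + w (t + 1) (α t))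
    (hrest : ∀ t i, i ≠ α t → i ≠ β (α t) → w (t + 1) i = w t i) : w 0 = 0 := by
  have hconst : ∀ t, w t (α t) = 0 → w (t + 1) = w t := by
    intro t ht
    have h0 : w (t + 1) (α t) = 0 := by have := hhalf t; omega
    funext i
    by_cases h1 : i = α t
    · rw [h1, h0, ht]
    · by_cases h2 : i = β (α t)
      · rw [h2, hshift, h0, add_zero]
      · exact hrest t i h1 h2
  have hback : ∀ t, w t = 0 → w 0 = 0 := by
    intro t
    induction t with
    | zero => exact id
    | succ t ih =>
      intro h
      refine ih ?_
      have h0 : w t (α t) = 0 := by rw [hhalf, h]; simp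
      rw [← hconst t h0, h]
  have hbound : ∀ t i, |w t i| ≤ 2 ^ t * ∑ j, |w 0 j| := by
    intro t
    induction t with
    | zero =>
      intro i
      simpa using Finset.single_le_sum (f := fun j => |w 0 j|) (fun _ _ => abs_nonneg _)
        (Finset.mem_univ i)
    | succ t ih =>
      have key : ∀ i, |w (t + 1) i| ≤ 2 * (2 ^ t * ∑ j, |w 0 j|) := by
        intro i
        have ha := ih (α t)
        have hi := ih i
        have hh := hhalf t
        by_cases h1 : i = α t
        · subst h1; grind
        · by_cases h2 : i = β (α t)
          · have hs := hshift t
            rw [← h2] at hs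
            grind
          · rw [hrest t i h1 h2]
            grind
      intro i
      rw [pow_succ', mul_assoc]
      exact key i
  have hphase : ∀ k j, j < 3 * 4 ^ k → (α (4 ^ k + j) : ℕ) = k % n := by
    intro k j hj
    rw [hα, Nat.log_eq_of_pow_le_of_lt_pow (m := k) (by omega) (by rw [pow_succ]; omega)]
  have hn : 0 < n := Fin.pos (α 0)
  obtain ⟨K, hK⟩ := pow_unbounded_of_one_lt (∑ j, |w 0 j|) (one_lt_two : (1 : ℤ) < 2)
  have hKpow : ∀ k, K ≤ k → K ≤ 4 ^ k := fun k hk =>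
    hk.trans (Nat.lt_pow_self (by norm_num)).le
  have hzero : ∀ k, K ≤ k → w (4 ^ k) ⟨k % n, Nat.mod_lt _ hn⟩ = 0 := by
    intro k hk
    set a : Fin n := ⟨k % n, Nat.mod_lt _ hn⟩
    have hpow : ∀ j, j ≤ 3 * 4 ^ k → w (4 ^ k) a = 2 ^ j * w (4 ^ k + j) a := by
      intro j
      induction j with
      | zero => simp
      | succ j ih =>
        intro hj
        have haj : α (4 ^ k + j) = a := Fin.ext (hphase k j (by omega))
        have hh := hhalf (4 ^ k + j)
        rw [haj] at hh
        rw [ih (by omega), hh, pow_succ]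
        ring_nf
    have hdvd : (2 : ℤ) ^ (3 * 4 ^ k) ∣ w (4 ^ k) a := ⟨_, hpow _ le_rfl⟩
    refine Int.eq_zero_of_abs_lt_dvd hdvd ((hbound _ _).trans_lt ?_)
    calc (2 : ℤ) ^ 4 ^ k * ∑ j, |w 0 j| < 2 ^ 4 ^ k * 2 ^ K := by gcongr
      _ = 2 ^ (4 ^ k + K) := (pow_add _ _ _).symm
      _ ≤ 2 ^ (3 * 4 ^ k) := by
        have := hKpow k hk
        exact pow_le_pow_right₀ (by norm_num) (by omega)
  have hstep : ∀ k, K ≤ k → w (4 ^ (k + 1)) = w (4 ^ k) := by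
    intro k hk
    have hj : ∀ j, j ≤ 3 * 4 ^ k → w (4 ^ k + j) = w (4 ^ k) := by
      intro j
      induction j with
      | zero => simp
      | succ j ih =>
        intro hj
        have hprev := ih (by omega)
        have haj : α (4 ^ k + j) = ⟨k % n, Nat.mod_lt _ hn⟩ :=
          Fin.ext (hphase k j (by omega))
        rw [← add_assoc, hconst _ (by rw [haj, hprev, hzero k hk]), hprev]
    rw [← hj _ le_rfl]
    congr 1
    ring
  have hstable : ∀ k, K ≤ k → w (4 ^ k) = w (4 ^ K) := by
    intro k hk
    induction k, hk using Nat.le_induction with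
    | base => rfl
    | succ k hk ih => rw [hstep k hk, ih]
  refine hback (4 ^ K) ?_
  funext i
  have hKi : K ≤ i + n * K := (Nat.le_mul_of_pos_left K hn).trans (Nat.le_add_left _ _)
  have hi : (⟨(i + n * K) % n, Nat.mod_lt _ hn⟩ : Fin n) = i :=
    Fin.ext (by simp [Nat.mod_eq_of_lt i.isLt])
  have h := hzero _ hKi
  rwa [hi, hstable _ hKi] at h

theorem latticeHom_injective {n : ℕ} (α : ℕ → Fin n) (β : Fin n → Fin n)
    (hβ : ∀ q, β q ≠ q) (hα : ∀ t, (α t : ℕ) = Nat.log 4 t % n) :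
    Function.Injective (latticeHom α β) := by
  refine (injective_iff_map_eq_one _).2 fun v hv => ?_
  let w : ℕ → Fin n → ℤ := fun t =>
    Nat.rec v.toAdd (fun t u => latticeSection (α t) (β (α t)) u false) t
  have hw : ∀ t, w (t + 1) = latticeSection (α t) (β (α t)) (w t) false := fun _ => rfl
  have htriv : ∀ t u, latticeAct α β t (w t) u = u := by
    intro t
    induction t with
    | zero => exact fun u => DFunLike.congr_fun (congrArg Subtype.val hv) u
    | succ t ih => exact fun u => (List.cons.inj (ih (false :: u))).2
  have heven : ∀ t, w t (α t) % 2 = 0 := by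
    intro t
    have h := (List.cons.inj (htriv t [false])).1
    simp only [Bool.false_xor, decide_eq_false_iff_not] at h
    omega
  refine Multiplicative.toAdd.injective
    (eq_zero_of_halving_trajectory α β hα w (fun t => ?_) (fun t => ?_) fun t i h1 h2 => ?_)
  · have := heven t
    simp only [hw, latticeSection]
    simp
    omega
  · have := heven t
    simp only [hw, latticeSection]
    simp [hβ]
    omega
  · simp [hw, latticeSection, h1, h2]

end TVAutomaton

/-- For every `n ≥ 2` there exists an invertible `n`-state time-varying
automaton over the binary alphabet generating a group isomorphic to the free abelian group
of rank `n`. -/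
theorem tva_free_abelian (n : ℕ) (hn : 2 ≤ n) :
    ∃ (A : TVAutomaton (Fin n)) (h : A.Invertible),
      Nonempty (A.genGroup h ≃* Multiplicative (Fin n → ℤ)) := by
  have : NeZero n := ⟨by omega⟩
  let α : ℕ → Fin n := fun t => ⟨Nat.log 4 t % n, Nat.mod_lt _ (by omega)⟩
  let β : Fin n → Fin n := fun q => q + 1
  have hβ : ∀ q, β q ≠ q := by
    intro q h
    have h1 : (1 : Fin n) = 0 := add_eq_left.1 h
    have h2 := congrArg Fin.val h1
    rw [Fin.val_one', Nat.mod_eq_of_lt (by omega), Fin.val_zero] at h2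
    omega
  refine ⟨TVAutomaton.latticeAutomaton α β, TVAutomaton.latticeAutomaton_invertible α β, ⟨?_⟩⟩
  rw [TVAutomaton.genGroup_latticeAutomaton α hβ]
  exact (MonoidHom.ofInjective
    (TVAutomaton.latticeHom_injective α β hβ fun _ => rfl)).symm
end

section
/- Let G = G(A) be the group generated by an invertible Mealy automaton A over the binary alphabet {0,1}, and let G₁ be its first level stabilizer. If {g² : g ∈ G} = {h² : h ∈ G₁}, then g² = id for every g ∈ G; in particular G is an elementary abelian 2-group. -/
namespace TVAutomaton

/-- The transformations of a Mealy automaton do not depend on the time of the first transition. -/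
theorem IsMealy.act_eq {Q : Type*} {A : TVAutomaton Q} (hM : A.IsMealy) :
    ∀ (w : List Bool) (i j : ℕ) (q : Q), A.act i q w = A.act j q w := by
  intro w
  induction w with
  | nil => intro i j q; rfl
  | cons x w ih =>
    intro i j q
    simp only [act]
    rw [(hM i).1, (hM i).2, (hM j).1, (hM j).2, ih (i + 1) (j + 1)]

/-- The group of a Mealy automaton is self-similar: the section of an element at a letter is again
an element, both for a prescribed letter `x` and for a prescribed image `y` of the letter. -/
theorem IsMealy.exists_section {Q : Type*} {A : TVAutomaton Q} (hM : A.IsMealy)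
    (h : A.Invertible) {g : ↥binTreeAut} (hg : g ∈ A.genGroup h) :
    (∀ x, ∃ y, ∃ g' ∈ A.genGroup h, ∀ w, g.1 (x :: w) = y :: g'.1 w) ∧
      (∀ y, ∃ x, ∃ g' ∈ A.genGroup h, ∀ w, g.1 (x :: w) = y :: g'.1 w) := by
  unfold genGroup at hg
  induction hg using Subgroup.closure_induction with
  | mem g hg =>
    obtain ⟨q, rfl⟩ := hg
    have key : ∀ x, ∃ g' ∈ A.genGroup h, ∀ w,
        (A.toAut h 0 q).1 (x :: w) = A.psi 0 q x :: g'.1 w := fun x =>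
      ⟨A.toAut h 0 (A.phi 0 q x), Subgroup.subset_closure ⟨_, rfl⟩, fun w =>
        congrArg (A.psi 0 q x :: ·) (hM.act_eq w 1 0 _)⟩
    refine ⟨fun x => ⟨_, key x⟩, fun y => ?_⟩
    obtain ⟨x, rfl⟩ := (h 0 q).2 y
    exact ⟨x, key x⟩
  | one =>
    exact ⟨fun x => ⟨x, 1, one_mem _, fun _ => rfl⟩, fun x => ⟨x, 1, one_mem _, fun _ => rfl⟩⟩
  | mul a b _ _ iha ihb =>
    constructor
    · intro x
      obtain ⟨y, b', hb', hb⟩ := ihb.1 x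
      obtain ⟨z, a', ha', ha⟩ := iha.1 y
      exact ⟨z, a' * b', mul_mem ha' hb', fun w => by
        simp [Equiv.Perm.mul_apply, hb, ha]⟩
    · intro z
      obtain ⟨y, a', ha', ha⟩ := iha.2 z
      obtain ⟨x, b', hb', hb⟩ := ihb.2 y
      exact ⟨x, a' * b', mul_mem ha' hb', fun w => by
        simp [Equiv.Perm.mul_apply, hb, ha]⟩
  | inv a _ iha =>
    have key : ∀ x y (a' : ↥binTreeAut), (∀ w, a.1 (x :: w) = y :: a'.1 w) →
        ∀ w, (a⁻¹).1 (y :: w) = x :: (a'⁻¹).1 w := by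
      intro x y a' ha w
      apply a.1.injective
      rw [ha]
      simp
    constructor
    · intro y
      obtain ⟨x, a', ha', ha⟩ := iha.2 y
      exact ⟨x, a'⁻¹, inv_mem ha', key x y a' ha⟩
    · intro x
      obtain ⟨y, a', ha', ha⟩ := iha.1 x
      exact ⟨y, a'⁻¹, inv_mem ha', key x y a' ha⟩

end TVAutomaton

/-- Let `G = G(A)` for an invertible Mealy automaton `A` over the binary
alphabet, and let `G₁` be the first level stabilizer.  If the sets of squares of `G` and of
`G₁` coincide, then `g ^ 2 = 1` for every `g ∈ G`; in particular `G` is an elementary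
abelian 2-group. -/
theorem mealy_squares_dichotomy (Q : Type) [Finite Q]
    (A : TVAutomaton Q) (h : A.Invertible) (hM : A.IsMealy)
    (hsq : (fun g : ↥binTreeAut => g ^ 2) '' (A.genGroup h : Set ↥binTreeAut) =
      (fun g : ↥binTreeAut => g ^ 2) '' {g | g ∈ A.genGroup h ∧ FixesLevelOne g}) :
    (∀ g ∈ A.genGroup h, g ^ 2 = 1) ∧
      (∀ g ∈ A.genGroup h, ∀ g' ∈ A.genGroup h, g * g' = g' * g) := by
  have sq : ∀ w : List Bool, ∀ g ∈ A.genGroup h, (g ^ 2).1 w = w := by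
    intro w
    induction w with
    | nil => intro g _; exact (g ^ 2).2.1
    | cons x w ih =>
      intro g hg
      obtain ⟨k, ⟨hk, hk₀, hk₁⟩, hkg⟩ := hsq.subset ⟨g, hg, rfl⟩
      obtain ⟨y, k', hk', hs⟩ := (hM.exists_section h hk).1 x
      have hxy : y = x := by
        have hy := hs []
        rw [k'.2.1] at hy
        cases x <;> simp_all
      subst hxy
      have hw := ih k' hk'
      simp only at hkg
      rw [← hkg]
      simp only [pow_two, Subgroup.coe_mul, Equiv.Perm.mul_apply] at hw ⊢
      rw [hs, hs, hw]
  have sq_one : ∀ g ∈ A.genGroup h, g ^ 2 = 1 := fun g hg =>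
    Subtype.ext (Equiv.ext fun w => sq w g hg)
  refine ⟨sq_one, fun a ha b hb => ?_⟩
  have inv_eq : ∀ g ∈ A.genGroup h, g⁻¹ = g := fun g hg =>
    inv_eq_of_mul_eq_one_left (by rw [← pow_two, sq_one g hg])
  rw [← inv_eq _ (mul_mem ha hb), mul_inv_rev, inv_eq a ha, inv_eq b hb]
end
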